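/- arXiv:2005.04282 — 3 statements merged into one kernel-verified Lean document; each statement's English description precedes it below -/
import Mathlib

section
/- Let r ≥ 3 and n ≥ 2r^5. If H is an intersecting r-uniform n-vertex hypergraph with minimum positive co-degree at least 3 having the maximum number of hyperedges among all such hypergraphs, then H is a 3-kernel system: there is a 5-element vertex set X such that the hyperedges of H are exactly the r-sets meeting X in at least 3 vertices. -/
open Finset

section Aux

set_option linter.unusedSectionVars false
set_option linter.unusedVariables false

variable {V : Type*} [Fintype V] [DecidableEq V]

/-- `T` is heavy: for every small set `Y` disjoint from `T`, some edge contains `T` and avoids `Y`. -/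
def Heavy (H : Finset (Finset V)) (r : ℕ) (T : Finset V) : Prop :=
  ∀ Y : Finset V, Y.card ≤ 2 * r → Disjoint Y T → ∃ e ∈ H, T ⊆ e ∧ Disjoint e Y

/-- Exchange property coming from the co-degree condition. -/
def Exch (H : Finset (Finset V)) : Prop :=
  ∀ e ∈ H, ∀ v ∈ e, ∀ Z : Finset V, Z.card ≤ 2 →
    ∃ w, w ∉ Z ∧ w ∉ e.erase v ∧ insert w (e.erase v) ∈ H

lemma exch_of_codeg (r : ℕ) (H : Finset (Finset V)) (hr : 3 ≤ r)
    (hunif : ∀ h ∈ H, h.card = r)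
    (hcodeg : ∀ S : Finset V, S.card = r - 1 → (∃ h ∈ H, S ⊆ h) →
      3 ≤ (H.filter fun h => S ⊆ h).card) : Exch H := by
  intro e he v hv Z hZ
  by_contra hcon
  push Not at hcon
  have h1 := hcodeg (e.erase v) (by rw [card_erase_of_mem hv, hunif e he])
    ⟨e, he, erase_subset _ _⟩
  have h2 : (H.filter fun h => e.erase v ⊆ h) ⊆ Z.image (fun w => insert w (e.erase v)) := by
    intro h hh
    rw [mem_filter] at hh
    obtain ⟨hh, hs⟩ := hh
    have hc : (h \ e.erase v).card = 1 := by
      rw [card_sdiff_of_subset hs, card_erase_of_mem hv, hunif e he, hunif h hh]; omega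
    obtain ⟨w, hw⟩ := card_eq_one.1 hc
    have hwm : w ∈ h \ e.erase v := by rw [hw]; simp
    rw [mem_sdiff] at hwm
    have heq : insert w (e.erase v) = h := by
      rw [insert_eq, ← hw, sdiff_union_of_subset hs]
    rw [mem_image]
    refine ⟨w, ?_, heq⟩
    by_contra hwZ
    exact hcon w hwZ hwm.2 (heq ▸ hh)
  have h3 := (card_le_card h2).trans card_image_le
  omega

lemma avoid_two (H : Finset (Finset V)) (hne : H.Nonempty) (hex : Exch H)
    (P : Finset V) (hP : P.card ≤ 2) : ∃ e ∈ H, Disjoint e P := by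
  obtain ⟨e, he, hmin⟩ := exists_min_image H (fun e => (e ∩ P).card) hne
  refine ⟨e, he, ?_⟩
  by_contra hd
  rw [not_disjoint_iff] at hd
  obtain ⟨v, hve, hvP⟩ := hd
  obtain ⟨w, hwP, -, hw⟩ := hex e he v hve P hP
  have h1 := hmin _ hw
  have h2 : insert w (e.erase v) ∩ P = (e ∩ P).erase v := by
    ext x; simp only [mem_inter, mem_insert, mem_erase]
    constructor
    · rintro ⟨rfl | h, h'⟩
      · exact absurd h' hwP
      · tauto
    · tauto
  simp only [h2] at h1
  have h3 := card_erase_lt_of_mem (mem_inter.2 ⟨hve, hvP⟩)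
  omega

lemma heavy_transversal (H : Finset (Finset V)) (r : ℕ) (T : Finset V)
    (hunif : ∀ h ∈ H, h.card = r)
    (hint : ∀ a ∈ H, ∀ b ∈ H, (a ∩ b).Nonempty)
    (hT : Heavy H r T) : ∀ e ∈ H, (e ∩ T).Nonempty := by
  intro e he
  by_contra h
  rw [← disjoint_iff_inter_eq_empty.trans not_nonempty_iff_eq_empty.symm] at h
  obtain ⟨f, hf, -, hd⟩ := hT e (by rw [hunif e he]; omega) h
  have := hint f hf e he
  rw [disjoint_iff_inter_eq_empty.1 hd] at this
  simp at this

lemma heavy_inter (H : Finset (Finset V)) (r : ℕ) (T T' : Finset V) (hr : 3 ≤ r)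
    (hunif : ∀ h ∈ H, h.card = r)
    (hint : ∀ a ∈ H, ∀ b ∈ H, (a ∩ b).Nonempty)
    (hc : T'.card = 3)
    (hT : Heavy H r T) (hT' : Heavy H r T') : (T ∩ T').Nonempty := by
  by_contra h
  rw [← disjoint_iff_inter_eq_empty.trans not_nonempty_iff_eq_empty.symm] at h
  obtain ⟨f, hf, -, hd⟩ := hT T' (by omega) h.symm
  have := heavy_transversal H r T' hunif hint hT' f hf
  rw [disjoint_iff_inter_eq_empty.1 hd] at this
  simp at this

lemma heavy_Q (H : Finset (Finset V)) (r : ℕ) (T g₁ g₂ : Finset V) (c : V) (hr : 3 ≤ r)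
    (hunif : ∀ h ∈ H, h.card = r)
    (hint : ∀ a ∈ H, ∀ b ∈ H, (a ∩ b).Nonempty) (hex : Exch H)
    (hc1 : g₁.card = 3) (hc2 : g₂.card = 3)
    (hT : Heavy H r T) (hg1 : Heavy H r g₁) (hg2 : Heavy H r g₂)
    (h1 : g₁ ∩ T = {c}) (h2 : g₂ ∩ T = {c}) : g₁ = g₂ := by
  have m1 : ∀ x, x ∈ g₁ → x ∈ T → x = c := fun x a b => by
    have : x ∈ g₁ ∩ T := mem_inter.2 ⟨a, b⟩
    rw [h1] at this; simpa using this
  have m2 : ∀ x, x ∈ g₂ → x ∈ T → x = c := fun x a b => by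
    have : x ∈ g₂ ∩ T := mem_inter.2 ⟨a, b⟩
    rw [h2] at this; simpa using this
  have c1 : c ∈ g₁ ∩ T := by rw [h1]; simp
  have c2 : c ∈ g₂ ∩ T := by rw [h2]; simp
  rw [mem_inter] at c1 c2
  obtain ⟨e, he, hTe, hd⟩ := hT ((g₁ ∪ g₂).erase c) (by
      have a1 := card_union_le g₁ g₂
      have a2 : ((g₁ ∪ g₂).erase c).card = _ := card_erase_of_mem (mem_union_left _ c1.1)
      omega) (by
      rw [disjoint_left]; intro x hx hxT
      rw [mem_erase, mem_union] at hx
      rcases hx.2 with h | h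
      · exact hx.1 (m1 x h hxT)
      · exact hx.1 (m2 x h hxT))
  have key : ∀ z, ∃ w, w ≠ c ∧ w ≠ z ∧ w ∈ g₁ ∧ w ∈ g₂ := by
    intro z
    obtain ⟨w, hwZ, -, hw⟩ := hex e he c (hTe c1.2) {c, z} card_le_two
    simp only [mem_insert, mem_singleton, not_or] at hwZ
    have aux : ∀ g, g ⊆ g₁ ∪ g₂ → Heavy H r g → w ∈ g := by
      intro g hg hgh
      obtain ⟨x, hx⟩ := heavy_transversal H r g hunif hint hgh _ hw
      rw [mem_inter, mem_insert, mem_erase] at hx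
      rcases hx.1 with rfl | h
      · exact hx.2
      · exact absurd (mem_erase.2 ⟨h.1, hg hx.2⟩) (disjoint_left.1 hd h.2)
    exact ⟨w, hwZ.1, hwZ.2, aux g₁ subset_union_left hg1, aux g₂ subset_union_right hg2⟩
  obtain ⟨w, hwc, -, hw1, hw2⟩ := key c
  obtain ⟨w', hwc', hww, hw1', hw2'⟩ := key w
  have hcard : ({c, w, w'} : Finset V).card = 3 := by
    rw [card_eq_three]; exact ⟨c, w, w', hwc.symm, hwc'.symm, hww.symm, rfl⟩
  have e1 : ({c, w, w'} : Finset V) = g₁ := eq_of_subset_of_card_le (by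
    intro x hx; simp only [mem_insert, mem_singleton] at hx
    rcases hx with rfl | rfl | rfl <;> tauto) (by omega)
  have e2 : ({c, w, w'} : Finset V) = g₂ := eq_of_subset_of_card_le (by
    intro x hx; simp only [mem_insert, mem_singleton] at hx
    rcases hx with rfl | rfl | rfl <;> tauto) (by omega)
  rw [← e1, e2]

/-- No pair of vertices lies in five heavy triples. -/
lemma no_sunflower (H : Finset (Finset V)) (r : ℕ) (hr : 3 ≤ r)
    (hunif : ∀ h ∈ H, h.card = r)
    (hint : ∀ a ∈ H, ∀ b ∈ H, (a ∩ b).Nonempty) (hex : Exch H)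
    (a b : V) (hab : a ≠ b) (X : Finset V) (hX : X.card = 5)
    (hXT : ∀ x ∈ X, x ≠ a ∧ x ≠ b ∧ Heavy H r {a, b, x}) : False := by
  have pick : ∀ Z : Finset V, Z.card ≤ 4 → ∃ x ∈ X, x ∉ Z := by
    intro Z hZ
    by_contra hcon
    push Not at hcon
    have := card_le_card (show X ⊆ Z from hcon)
    omega
  -- first edge
  obtain ⟨x₁, hx₁, -⟩ := pick ∅ (by simp)
  obtain ⟨hx₁a, hx₁b, hh₁⟩ := hXT x₁ hx₁
  obtain ⟨e₁, he₁, hs₁, hd₁⟩ := hh₁ (X.erase x₁) (by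
      rw [card_erase_of_mem hx₁]; omega) (by
      rw [disjoint_left]; intro x hx
      rw [mem_erase] at hx
      have := hXT x hx.2
      simp only [mem_insert, mem_singleton]; tauto)
  obtain ⟨u₁, hu₁a, -, hE₁⟩ := hex e₁ he₁ a (hs₁ (by simp)) {a} (by simp)
  rw [mem_singleton] at hu₁a
  set h₁ := insert u₁ (e₁.erase a) with hh₁def
  have h₁a : a ∉ h₁ := by simp [hh₁def, Ne.symm hu₁a]
  have h₁X : ∀ x ∈ X, x ∈ h₁ → x = x₁ ∨ x = u₁ := by
    intro x hx hxh
    rw [hh₁def, mem_insert, mem_erase] at hxh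
    by_contra hcon
    push Not at hcon
    have h := hxh.resolve_left hcon.2
    exact disjoint_left.1 hd₁ h.2 (mem_erase.2 ⟨hcon.1, hx⟩)
  -- second edge
  obtain ⟨x₂, hx₂, hx₂n⟩ := pick {x₁, u₁} (card_le_two.trans (by norm_num))
  simp only [mem_insert, mem_singleton, not_or] at hx₂n
  have hx₂h : x₂ ∉ h₁ := fun h => by have := h₁X x₂ hx₂ h; tauto
  obtain ⟨hx₂a, hx₂b, hh₂⟩ := hXT x₂ hx₂
  obtain ⟨e₂, he₂, hs₂, hd₂⟩ := hh₂ ((h₁.erase b) ∪ (X.erase x₂)) (by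
      refine (card_union_le _ _).trans ?_
      have a1 : (X.erase x₂).card = _ := card_erase_of_mem hx₂
      have b1 : b ∈ h₁ := by
        rw [hh₁def, mem_insert, mem_erase]; exact Or.inr ⟨hab.symm, hs₁ (by simp)⟩
      have a2 : (h₁.erase b).card = _ := card_erase_of_mem b1
      have := hunif _ hE₁
      omega) (by
      rw [disjoint_left]; intro x hx
      simp only [mem_insert, mem_singleton, not_or]
      rw [mem_union, mem_erase, mem_erase] at hx
      rcases hx with hx | hx
      · exact ⟨fun h => h₁a (h ▸ hx.2), hx.1, fun h => hx₂h (h ▸ hx.2)⟩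
      · have := hXT x hx.2; tauto)
  obtain ⟨u₂, hu₂a, -, hE₂⟩ := hex e₂ he₂ a (hs₂ (by simp)) {a} (by simp)
  rw [mem_singleton] at hu₂a
  set h₂ := insert u₂ (e₂.erase a) with hh₂def
  have h₂a : a ∉ h₂ := by simp [hh₂def, Ne.symm hu₂a]
  have h₂X : ∀ x ∈ X, x ∈ h₂ → x = x₂ ∨ x = u₂ := by
    intro x hx hxh
    rw [hh₂def, mem_insert, mem_erase] at hxh
    by_contra hcon
    push Not at hcon
    have h := hxh.resolve_left hcon.2
    exact disjoint_left.1 hd₂ h.2 (mem_union_right _ (mem_erase.2 ⟨hcon.1, hx⟩))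
  have h₁₂ : ∀ x, x ∈ h₁ → x ∈ h₂ → x = b ∨ x = u₂ := by
    intro x hx1 hx2
    rw [hh₂def, mem_insert, mem_erase] at hx2
    by_contra hcon
    push Not at hcon
    have h := hx2.resolve_left hcon.2
    exact disjoint_left.1 hd₂ h.2 (mem_union_left _ (mem_erase.2 ⟨hcon.1, hx1⟩))
  -- third edge
  obtain ⟨x₃, hx₃, hx₃n⟩ := pick {x₁, u₁, x₂, u₂} card_le_four
  simp only [mem_insert, mem_singleton, not_or] at hx₃n
  have hx₃h₁ : x₃ ∉ h₁ := fun h => by have := h₁X x₃ hx₃ h; tauto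
  have hx₃h₂ : x₃ ∉ h₂ := fun h => by have := h₂X x₃ hx₃ h; tauto
  obtain ⟨hx₃a, hx₃b, hh₃⟩ := hXT x₃ hx₃
  obtain ⟨e₃, he₃, hs₃, hd₃⟩ := hh₃ ((h₁ ∪ h₂).erase b) (by
      refine (card_le_card (erase_subset _ _)).trans ((card_union_le _ _).trans ?_)
      have := hunif _ hE₁
      have := hunif _ hE₂
      omega) (by
      rw [disjoint_left]; intro x hx
      simp only [mem_insert, mem_singleton, not_or]
      rw [mem_erase, mem_union] at hx
      rcases hx.2 with h | h
      · exact ⟨fun h' => h₁a (h' ▸ h), hx.1, fun h' => hx₃h₁ (h' ▸ h)⟩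
      · exact ⟨fun h' => h₂a (h' ▸ h), hx.1, fun h' => hx₃h₂ (h' ▸ h)⟩)
  obtain ⟨u₃, hu₃, -, hE₃⟩ := hex e₃ he₃ b (hs₃ (by simp)) {b, u₂} card_le_two
  simp only [mem_insert, mem_singleton, not_or] at hu₃
  have aux : ∀ h, h ⊆ h₁ ∪ h₂ → h ∈ H → u₃ ∈ h := by
    intro h hs hh
    obtain ⟨x, hx⟩ := hint _ hE₃ h hh
    rw [mem_inter, mem_insert, mem_erase] at hx
    rcases hx.1 with rfl | h'
    · exact hx.2
    · exact absurd (mem_erase.2 ⟨h'.1, hs hx.2⟩) (disjoint_left.1 hd₃ h'.2)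
  have := h₁₂ u₃ (aux h₁ subset_union_left hE₁) (aux h₂ subset_union_right hE₂)
  tauto

/-! Purely combinatorial analysis of triple systems. -/

lemma link_small (A : Finset (Finset V))
    (hQ : ∀ T ∈ A, ∀ g₁ ∈ A, ∀ g₂ ∈ A, ∀ c, g₁ ∩ T = {c} → g₂ ∩ T = {c} → g₁ = g₂)
    (a b c x y z : V) (hab : a ≠ b) (hac : a ≠ c) (hbc : b ≠ c)
    (hx : ({a, b, x} : Finset V) ∈ A) (hxc : x ≠ c)
    (hy : ({b, c, y} : Finset V) ∈ A) (hz : ({b, c, z} : Finset V) ∈ A)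
    (hya : y ≠ a) (hyb : y ≠ b) (hyc : y ≠ c) (hyx : y ≠ x)
    (hza : z ≠ a) (hzb : z ≠ b) (hzx : z ≠ x) : y = z := by
  have h := hQ _ hx _ hy _ hz b (by ext t; simp; grind) (by ext t; simp; grind)
  have : y ∈ ({b, c, z} : Finset V) := by rw [← h]; simp
  simp at this
  tauto

lemma five_hit (e : Finset V) (a b c x y : V) (hab : a ≠ b) (hac : a ≠ c) (hbc : b ≠ c)
    (hxa : x ≠ a) (hxb : x ≠ b) (hxc : x ≠ c) (hya : y ≠ a) (hyb : y ≠ b) (hyc : y ≠ c)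
    (hxy : x ≠ y)
    (f1 : a ∈ e ∨ b ∈ e ∨ c ∈ e) (f2 : a ∈ e ∨ b ∈ e ∨ x ∈ e) (f3 : a ∈ e ∨ b ∈ e ∨ y ∈ e)
    (f4 : b ∈ e ∨ c ∈ e ∨ x ∈ e) (f5 : b ∈ e ∨ c ∈ e ∨ y ∈ e) (f6 : a ∈ e ∨ c ∈ e ∨ x ∈ e)
    (f7 : a ∈ e ∨ c ∈ e ∨ y ∈ e) (f8 : a ∈ e ∨ x ∈ e ∨ y ∈ e) (f9 : b ∈ e ∨ x ∈ e ∨ y ∈ e)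
    (f10 : c ∈ e ∨ x ∈ e ∨ y ∈ e) : 3 ≤ (e ∩ {a, b, c, x, y}).card := by
  have fin : ∀ u v w, u ∈ e → v ∈ e → w ∈ e → u ≠ v → u ≠ w → v ≠ w →
      ({u, v, w} : Finset V) ⊆ {a, b, c, x, y} → 3 ≤ (e ∩ {a, b, c, x, y}).card := by
    intro u v w hu hv hw huv huw hvw hsub
    rw [← card_eq_three.2 ⟨u, v, w, huv, huw, hvw, rfl⟩]
    refine card_le_card (subset_inter ?_ hsub)
    intro t ht; simp only [mem_insert, mem_singleton] at ht
    rcases ht with rfl | rfl | rfl <;> assumption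
  have fin' : ∀ u v w, u ∈ e → v ∈ e → w ∈ e → u ≠ v → u ≠ w → v ≠ w →
      u ∈ ({a, b, c, x, y} : Finset V) → v ∈ ({a, b, c, x, y} : Finset V) →
      w ∈ ({a, b, c, x, y} : Finset V) → 3 ≤ (e ∩ {a, b, c, x, y}).card := by
    intro u v w hu hv hw huv huw hvw m1 m2 m3
    refine fin u v w hu hv hw huv huw hvw ?_
    intro t ht; simp only [mem_insert, mem_singleton] at ht
    rcases ht with rfl | rfl | rfl <;> assumption
  have ma : a ∈ ({a, b, c, x, y} : Finset V) := by simp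
  have mb : b ∈ ({a, b, c, x, y} : Finset V) := by simp
  have mc : c ∈ ({a, b, c, x, y} : Finset V) := by simp
  have mx : x ∈ ({a, b, c, x, y} : Finset V) := by simp
  have my : y ∈ ({a, b, c, x, y} : Finset V) := by simp
  by_cases ea : a ∈ e <;> by_cases eb : b ∈ e
  · by_cases ec : c ∈ e
    · exact fin' a b c ea eb ec hab hac hbc ma mb mc
    by_cases ex : x ∈ e
    · exact fin' a b x ea eb ex hab hxa.symm hxb.symm ma mb mx
    · exact fin' a b y ea eb ((f10.resolve_left ec).resolve_left ex) hab hya.symm hyb.symm ma mb my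
  · by_cases ec : c ∈ e
    · by_cases ex : x ∈ e
      · exact fin' a c x ea ec ex hac hxa.symm hxc.symm ma mc mx
      · exact fin' a c y ea ec ((f9.resolve_left eb).resolve_left ex) hac hya.symm hyc.symm ma mc my
    · exact fin' a x y ea ((f4.resolve_left eb).resolve_left ec) ((f5.resolve_left eb).resolve_left ec) hxa.symm hya.symm hxy ma mx my
  · by_cases ec : c ∈ e
    · by_cases ex : x ∈ e
      · exact fin' b c x eb ec ex hbc hxb.symm hxc.symm mb mc mx
      · exact fin' b c y eb ec ((f8.resolve_left ea).resolve_left ex) hbc hyb.symm hyc.symm mb mc my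
    · exact fin' b x y eb ((f6.resolve_left ea).resolve_left ec) ((f7.resolve_left ea).resolve_left ec) hxb.symm hyb.symm hxy mb mx my
  · exact fin' c x y ((f1.resolve_left ea).resolve_left eb) ((f2.resolve_left ea).resolve_left eb) ((f3.resolve_left ea).resolve_left eb) hxc.symm hyc.symm hxy mc mx my

set_option maxHeartbeats 1000000 in
lemma triple_system (A : Finset (Finset V)) (h3 : ∀ T ∈ A, T.card = 3)
    (hI : ∀ T ∈ A, ∀ T' ∈ A, (T ∩ T').Nonempty)
    (hQ : ∀ T ∈ A, ∀ g₁ ∈ A, ∀ g₂ ∈ A, ∀ c, g₁ ∩ T = {c} → g₂ ∩ T = {c} → g₁ = g₂)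
    (hS : ∀ a b, a ≠ b → (univ.filter fun x => x ≠ a ∧ x ≠ b ∧ ({a, b, x} : Finset V) ∈ A).card ≤ 4)
    (h10 : 10 ≤ A.card) :
    ∃ X : Finset V, X.card = 5 ∧
      ∀ e : Finset V, (∀ T ∈ A, (e ∩ T).Nonempty) → 3 ≤ (e ∩ X).card := by
  obtain ⟨T, hT⟩ : A.Nonempty := card_pos.1 (by omega)
  obtain ⟨a, b, c, hab, hac, hbc, rfl⟩ := card_eq_three.1 (h3 T hT)
  set L : V → V → V → Finset V := fun u v w =>
    univ.filter fun x => x ≠ u ∧ x ≠ v ∧ x ≠ w ∧ ({u, v, x} : Finset V) ∈ A with hL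
  have memL : ∀ u v w x, x ∈ L u v w ↔ x ≠ u ∧ x ≠ v ∧ x ≠ w ∧ ({u, v, x} : Finset V) ∈ A := by
    intro u v w x; simp [hL]
  have Lcard : ∀ u v w, u ≠ v → u ≠ w → v ≠ w → ({u, v, w} : Finset V) ∈ A → (L u v w).card ≤ 3 := by
    intro u v w huv huw hvw hm
    have h := hS u v huv
    have hss : insert w (L u v w) ⊆
        (univ.filter fun x => x ≠ u ∧ x ≠ v ∧ ({u, v, x} : Finset V) ∈ A) := by
      intro x hx
      rw [mem_insert, memL] at hx
      rw [mem_filter]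
      rcases hx with rfl | hx
      · exact ⟨mem_univ _, huw.symm, hvw.symm, hm⟩
      · exact ⟨mem_univ _, hx.1, hx.2.1, hx.2.2.2⟩
    have h' := card_le_card hss
    rw [card_insert_of_notMem (by rw [memL]; tauto)] at h'
    omega
  have Lsymm : ∀ u v w, L u v w = L v u w := by
    intro u v w; ext x; rw [memL, memL, insert_comm]; tauto
  -- interaction of links
  have Lsm : ∀ u v w, u ≠ v → u ≠ w → v ≠ w → ∀ x ∈ L u v w, ((L v w u).erase x).card ≤ 1 := by
    intro u v w huv huw hvw x hx
    rw [card_le_one]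
    intro y hy z hz
    rw [mem_erase, memL] at hy hz
    rw [memL] at hx
    exact link_small A hQ u v w x y z huv huw hvw hx.2.2.2 hx.2.2.1 hy.2.2.2.2 hz.2.2.2.2
      hy.2.2.2.1 hy.2.1 hy.2.2.1 hy.1 hz.2.2.2.1 hz.2.1 hz.1
  have Lle2 : ∀ u v w, u ≠ v → u ≠ w → v ≠ w → (L u v w).Nonempty → (L v w u).card ≤ 2 := by
    rintro u v w huv huw hvw ⟨x, hx⟩
    have := Lsm u v w huv huw hvw x hx
    have := pred_card_le_card_erase (s := L v w u) (a := x)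
    omega
  set S : V → Finset (Finset V) := fun v => A.filter fun g => g ∩ {a, b, c} = {v} with hSdef
  have Scard : ∀ v, (S v).card ≤ 1 := by
    intro v
    rw [card_le_one]
    intro g hg g' hg'
    rw [hSdef, mem_filter] at hg hg'
    exact hQ _ hT g hg.1 g' hg'.1 v hg.2 hg'.2
  have cover : A ⊆ {{a, b, c}} ∪ (L a b c).image (fun x => {a, b, x}) ∪
      (L b c a).image (fun x => {b, c, x}) ∪ (L a c b).image (fun x => {a, c, x}) ∪
      (S a ∪ S b ∪ S c) := by
    intro g hg
    have hgT := hI g hg _ hT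
    have hg3 := h3 g hg
    have two : ∀ u v w, u ≠ v → u ≠ w → v ≠ w → u ∈ g → v ∈ g → w ∉ g →
        ∃ x ∈ L u v w, ({u, v, x} : Finset V) = g := by
      intro u v w huv huw hvw hu hv hw
      have h1 : ((g.erase u).erase v).card = 1 := by
        rw [card_erase_of_mem (mem_erase.2 ⟨huv.symm, hv⟩), card_erase_of_mem hu]; omega
      obtain ⟨x, hx⟩ := card_eq_one.1 h1
      have hxm : x ∈ (g.erase u).erase v := by rw [hx]; simp
      rw [mem_erase, mem_erase] at hxm
      have heq : ({u, v, x} : Finset V) = g := by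
        rw [← hx, insert_erase (mem_erase.2 ⟨huv.symm, hv⟩), insert_erase hu]
      refine ⟨x, ?_, heq⟩
      rw [memL]
      exact ⟨hxm.2.1, hxm.1, fun h => hw (h ▸ hxm.2.2), heq ▸ hg⟩
    have one : ∀ v, g ∩ {a, b, c} = {v} → g ∈ S v := by
      intro v h; rw [hSdef, mem_filter]; exact ⟨hg, h⟩
    simp only [mem_union, mem_image, mem_singleton]
    by_cases ha : a ∈ g <;> by_cases hb : b ∈ g <;> by_cases hc : c ∈ g
    · have : ({a, b, c} : Finset V) = g := by
        refine eq_of_subset_of_card_le ?_ (by rw [hg3, h3 _ hT])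
        intro x hx; simp only [mem_insert, mem_singleton] at hx
        rcases hx with rfl | rfl | rfl <;> assumption
      tauto
    · exact Or.inl (Or.inl (Or.inl (Or.inr (two a b c hab hac hbc ha hb hc))))
    · exact Or.inl (Or.inr (two a c b hac hab hbc.symm ha hc hb))
    · have := one a (by ext t; simp; grind); tauto
    · exact Or.inl (Or.inl (Or.inr (two b c a hbc hab.symm hac.symm hb hc ha)))
    · have := one b (by ext t; simp; grind); tauto
    · have := one c (by ext t; simp; grind); tauto
    · obtain ⟨x, hx⟩ := hgT
      simp only [mem_inter, mem_insert, mem_singleton] at hx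
      exfalso
      rcases hx with ⟨h1, rfl | rfl | rfl⟩ <;> contradiction
  have c0 := card_le_card cover
  have c1 := card_union_le ({{a, b, c}} ∪ (L a b c).image (fun x => {a, b, x}) ∪
      (L b c a).image (fun x => {b, c, x}) ∪ (L a c b).image (fun x => {a, c, x}))
      (S a ∪ S b ∪ S c)
  have c2 := card_union_le ({{a, b, c}} ∪ (L a b c).image (fun x => {a, b, x}) ∪
      (L b c a).image (fun x => {b, c, x})) ((L a c b).image (fun x => ({a, c, x} : Finset V)))
  have c3 := card_union_le ({{a, b, c}} ∪ (L a b c).image (fun x => {a, b, x}))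
      ((L b c a).image (fun x => ({b, c, x} : Finset V)))
  have c4 := card_union_le {{a, b, c}} ((L a b c).image (fun x => ({a, b, x} : Finset V)))
  have c5 := card_union_le (S a ∪ S b) (S c)
  have c6 := card_union_le (S a) (S b)
  have c7 : ((L a b c).image (fun x => ({a, b, x} : Finset V))).card ≤ _ := card_image_le
  have c8 : ((L b c a).image (fun x => ({b, c, x} : Finset V))).card ≤ _ := card_image_le
  have c9 : ((L a c b).image (fun x => ({a, c, x} : Finset V))).card ≤ _ := card_image_le
  have c10 : ({{a, b, c}} : Finset (Finset V)).card = 1 := card_singleton _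
  have sa := Scard a
  have sb := Scard b
  have sc := Scard c
  have p3 := Lcard a b c hab hac hbc hT
  have q3 := Lcard b c a hbc hab.symm hac.symm (by
    have : ({b, c, a} : Finset V) = {a, b, c} := by ext; simp; tauto
    rwa [this])
  have s3 := Lcard a c b hac hab hbc.symm (by
    have : ({a, c, b} : Finset V) = {a, b, c} := by ext; simp; tauto
    rwa [this])
  have pq : 0 < (L a b c).card → (L b c a).card ≤ 2 := fun h =>
    Lle2 a b c hab hac hbc (card_pos.1 h)
  have ps : 0 < (L a b c).card → (L a c b).card ≤ 2 := fun h =>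
    Lle2 b a c hab.symm hbc hac (by rw [Lsymm]; exact card_pos.1 h)
  have qp : 0 < (L b c a).card → (L a b c).card ≤ 2 := fun h => by
    rw [Lsymm]
    exact Lle2 c b a hbc.symm hac.symm hab.symm (by rw [Lsymm]; exact card_pos.1 h)
  have qs : 0 < (L b c a).card → (L a c b).card ≤ 2 := fun h => by
    rw [Lsymm]
    exact Lle2 b c a hbc hab.symm hac.symm (card_pos.1 h)
  have sp : 0 < (L a c b).card → (L a b c).card ≤ 2 := fun h =>
    Lle2 c a b hac.symm hbc.symm hab (by rw [Lsymm]; exact card_pos.1 h)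
  have sq : 0 < (L a c b).card → (L b c a).card ≤ 2 := fun h => by
    rw [Lsymm]
    exact Lle2 a c b hac hab hbc.symm (card_pos.1 h)
  have hp : (L a b c).card = 2 := by omega
  have hq : (L b c a).card = 2 := by omega
  have hs : (L a c b).card = 2 := by omega
  have hsa : (S a).card = 1 := by omega
  have hsb : (S b).card = 1 := by omega
  have hsc : (S c).card = 1 := by omega
  have sub1 : L a b c ⊆ L b c a := by
    intro x hx
    by_contra hn
    have := Lsm a b c hab hac hbc x hx
    rw [erase_eq_of_notMem hn] at this
    omega
  have sub2 : L a b c ⊆ L a c b := by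
    intro x hx
    by_contra hn
    rw [Lsymm] at hx
    have := Lsm b a c hab.symm hbc hac x hx
    rw [erase_eq_of_notMem hn] at this
    omega
  obtain ⟨x, y, hxy, hLxy⟩ := card_eq_two.1 hp
  have hx : x ∈ L a b c := by rw [hLxy]; simp
  have hy : y ∈ L a b c := by rw [hLxy]; simp
  have hx1 := sub1 hx
  have hx2 := sub2 hx
  have hy1 := sub1 hy
  have hy2 := sub2 hy
  rw [memL] at hx hy hx1 hx2 hy1 hy2
  have third : ∀ u v w, ({v, w, x} : Finset V) ∈ A → ({v, w, y} : Finset V) ∈ A →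
      u ≠ v → u ≠ w → v ∈ ({a, b, c} : Finset V) → w ∈ ({a, b, c} : Finset V) →
      x ≠ u → y ≠ u →
      (S u).card = 1 → ({u, x, y} : Finset V) ∈ A := by
    intro u v w hvx hvy huv huw hv hw hxu hyu hSu
    obtain ⟨g, hg⟩ := card_eq_one.1 hSu
    have hgm : g ∈ S u := by rw [hg]; simp
    rw [hSdef, mem_filter] at hgm
    obtain ⟨hgA, hgi⟩ := hgm
    have hu : u ∈ g := by
      have : u ∈ g ∩ {a, b, c} := by rw [hgi]; simp
      exact (mem_inter.1 this).1
    have nin : ∀ t, t ∈ ({a, b, c} : Finset V) → u ≠ t → t ∉ g := by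
      intro t ht hut htg
      have : t ∈ g ∩ {a, b, c} := mem_inter.2 ⟨htg, ht⟩
      rw [hgi, mem_singleton] at this
      exact hut this.symm
    have hv' := nin v hv huv
    have hw' := nin w hw huw
    have hmem : ∀ t, ({v, w, t} : Finset V) ∈ A → t ∈ g := by
      intro t ht
      obtain ⟨s, hs⟩ := hI g hgA _ ht
      simp only [mem_inter, mem_insert, mem_singleton] at hs
      rcases hs with ⟨h1, rfl | rfl | rfl⟩ <;> tauto
    have hxg := hmem x hvx
    have hyg := hmem y hvy
    have : ({u, x, y} : Finset V) = g := by
      refine eq_of_subset_of_card_le ?_ ?_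
      · intro t ht; simp only [mem_insert, mem_singleton] at ht
        rcases ht with rfl | rfl | rfl <;> assumption
      · rw [h3 g hgA, card_eq_three.2 ⟨u, x, y, hxu.symm, hyu.symm, hxy, rfl⟩]
    rwa [this]
  have ta := third a b c hx1.2.2.2 hy1.2.2.2 hab hac (by simp) (by simp) hx.1 hy.1 hsa
  have tb := third b a c hx2.2.2.2 hy2.2.2.2 hab.symm hbc (by simp) (by simp) hx.2.1 hy.2.1 hsb
  have tc := third c a b hx.2.2.2 hy.2.2.2 hac.symm hbc.symm (by simp) (by simp)
    hx.2.2.1 hy.2.2.1 hsc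
  refine ⟨{a, b, c, x, y}, ?_, ?_⟩
  · rw [card_insert_of_notMem, card_insert_of_notMem, card_eq_three.2 ⟨c, x, y, _, _, _, rfl⟩] <;>
      simp <;> grind
  · intro e he
    have hit : ∀ u v w, ({u, v, w} : Finset V) ∈ A → u ∈ e ∨ v ∈ e ∨ w ∈ e := by
      intro u v w h
      obtain ⟨t, ht⟩ := he _ h
      simp only [mem_inter, mem_insert, mem_singleton] at ht
      rcases ht with ⟨h1, rfl | rfl | rfl⟩
      · exact Or.inl h1
      · exact Or.inr (Or.inl h1)
      · exact Or.inr (Or.inr h1)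
    have f1 := hit _ _ _ hT
    have f2 := hit _ _ _ hx.2.2.2
    have f3 := hit _ _ _ hy.2.2.2
    have f4 := hit _ _ _ hx1.2.2.2
    have f5 := hit _ _ _ hy1.2.2.2
    have f6 := hit _ _ _ hx2.2.2.2
    have f7 := hit _ _ _ hy2.2.2.2
    have f8 := hit _ _ _ ta
    have f9 := hit _ _ _ tb
    have f10 := hit _ _ _ tc
    exact five_hit e a b c x y hab hac hbc hx.1 hx.2.1 hx.2.2.1 hy.1 hy.2.1 hy.2.2.1 hxy
      f1 f2 f3 f4 f5 f6 f7 f8 f9 f10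

/-! Counting. -/

lemma card_containing (H : Finset (Finset V)) (r : ℕ) (hunif : ∀ h ∈ H, h.card = r)
    (S : Finset V) :
    (H.filter fun h => S ⊆ h).card ≤ (Fintype.card V - S.card).choose (r - S.card) := by
  rw [← card_compl, ← card_powersetCard]
  refine card_le_card_of_injOn (fun h => h \ S) ?_ ?_
  · intro h hh
    rw [mem_coe, mem_filter] at hh
    rw [mem_coe, mem_powersetCard]
    refine ⟨fun x hx => ?_, ?_⟩
    · rw [mem_sdiff] at hx; rw [mem_compl]; exact hx.2
    · rw [card_sdiff_of_subset hh.2, hunif h hh.1]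
  · intro h hh h' hh' heq
    rw [mem_coe, mem_filter] at hh hh'
    simp only at heq
    rw [← sdiff_union_of_subset hh.2, heq, sdiff_union_of_subset hh'.2]

/-- bound for the number of `r`-sets through four points -/
def D4 (r n : ℕ) : ℕ := if r = 3 then 0 else (n - 4).choose (r - 4)

lemma card_containing_four (H : Finset (Finset V)) (r : ℕ) (hr : 3 ≤ r)
    (hunif : ∀ h ∈ H, h.card = r) (S : Finset V) (hS : S.card = 4) :
    (H.filter fun h => S ⊆ h).card ≤ D4 r (Fintype.card V) := by
  unfold D4
  split_ifs with h
  · rw [Nat.le_zero, card_eq_zero, filter_eq_empty_iff]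
    intro e he hs
    have := card_le_card hs
    have := hunif e he
    omega
  · have := card_containing H r hunif S
    rwa [hS] at this

lemma light_bound (H : Finset (Finset V)) (r : ℕ) (hr : 3 ≤ r)
    (hunif : ∀ h ∈ H, h.card = r) (T : Finset V) (hT : T.card = 3) (hl : ¬ Heavy H r T) :
    (H.filter fun h => T ⊆ h).card ≤ 2 * r * D4 r (Fintype.card V) := by
  unfold Heavy at hl
  push Not at hl
  obtain ⟨Y, hY, hd, hh⟩ := hl
  have hsub : (H.filter fun h => T ⊆ h) ⊆ Y.biUnion fun y => H.filter fun h => insert y T ⊆ h := by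
    intro e he
    rw [mem_filter] at he
    obtain ⟨y, hye, hyY⟩ := not_disjoint_iff.1 (hh e he.1 he.2)
    rw [mem_biUnion]
    exact ⟨y, hyY, mem_filter.2 ⟨he.1, insert_subset hye he.2⟩⟩
  refine (card_le_card hsub).trans ((card_biUnion_le_card_mul Y _ (D4 r (Fintype.card V)) ?_).trans
    (Nat.mul_le_mul_right _ hY))
  intro y hy
  exact card_containing_four H r hr hunif _ (by
    rw [card_insert_of_notMem (disjoint_left.1 hd hy), hT])

lemma branch (H : Finset (Finset V)) (r k : ℕ) (hunif : ∀ h ∈ H, h.card = r)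
    (hint : ∀ a ∈ H, ∀ b ∈ H, (a ∩ b).Nonempty)
    (hav : ∀ P : Finset V, P.card = k → ∃ e ∈ H, Disjoint e P)
    (F : Finset (Finset V)) (hF : ∀ P ∈ F, P.card = k) (hcov : ∀ e ∈ H, ∃ P ∈ F, P ⊆ e) :
    ∃ F' : Finset (Finset V), F'.card ≤ F.card * r ∧ (∀ P ∈ F', P.card = k + 1) ∧
      ∀ e ∈ H, ∃ P ∈ F', P ⊆ e := by
  classical
  have : ∀ P : Finset V, ∃ e : Finset V, P.card = k → e ∈ H ∧ Disjoint e P := by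
    intro P
    by_cases h : P.card = k
    · obtain ⟨e, he, hd⟩ := hav P h
      exact ⟨e, fun _ => ⟨he, hd⟩⟩
    · exact ⟨∅, fun h' => absurd h' h⟩
  choose φ hφ using this
  refine ⟨F.biUnion fun P => (φ P).image fun v => insert v P, ?_, ?_, ?_⟩
  · refine card_biUnion_le_card_mul _ _ _ fun P hP => card_image_le.trans ?_
    rw [hunif _ (hφ P (hF P hP)).1]
  · intro Q hQ
    rw [mem_biUnion] at hQ
    obtain ⟨P, hP, hQ⟩ := hQ
    rw [mem_image] at hQ
    obtain ⟨v, hv, rfl⟩ := hQ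
    rw [card_insert_of_notMem (disjoint_left.1 (hφ P (hF P hP)).2 hv), hF P hP]
  · intro e he
    obtain ⟨P, hP, hs⟩ := hcov e he
    obtain ⟨v, hv⟩ := hint e he _ (hφ P (hF P hP)).1
    rw [mem_inter] at hv
    exact ⟨insert v P, mem_biUnion.2 ⟨P, hP, mem_image.2 ⟨v, hv.2, rfl⟩⟩, insert_subset hv.1 hs⟩

open Classical in
lemma upper_bound (H : Finset (Finset V)) (r : ℕ) (hr : 3 ≤ r) (hne : H.Nonempty)
    (hunif : ∀ h ∈ H, h.card = r)
    (hint : ∀ a ∈ H, ∀ b ∈ H, (a ∩ b).Nonempty) (hex : Exch H) :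
    H.card ≤ ((univ.powersetCard 3).filter fun T : Finset V => Heavy H r T).card *
      (Fintype.card V - 3).choose (r - 3) + r ^ 3 * (2 * r * D4 r (Fintype.card V)) := by
  have hav : ∀ k, k ≤ 2 → ∀ P : Finset V, P.card = k → ∃ e ∈ H, Disjoint e P :=
    fun k hk P hP => avoid_two H hne hex P (by omega)
  obtain ⟨F1, n1, k1, cov1⟩ := branch H r 0 hunif hint (hav 0 (by omega)) {∅} (by simp) (by simp)
  obtain ⟨F2, n2, k2, cov2⟩ := branch H r 1 hunif hint (hav 1 (by omega)) F1 k1 cov1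
  obtain ⟨F, n3, k3, cov3⟩ := branch H r 2 hunif hint (hav 2 (by omega)) F2 k2 cov2
  have hF : F.card ≤ r ^ 3 := by
    rw [card_singleton, one_mul] at n1
    calc F.card ≤ F2.card * r := n3
      _ ≤ (F1.card * r) * r := Nat.mul_le_mul_right _ n2
      _ ≤ (r * r) * r := Nat.mul_le_mul_right _ (Nat.mul_le_mul_right _ n1)
      _ = r ^ 3 := by ring
  set C := (Fintype.card V - 3).choose (r - 3) with hC
  set D := 2 * r * D4 r (Fintype.card V) with hD
  have hsub : H ⊆ (F.filter fun T => Heavy H r T).biUnion (fun T => H.filter fun h => T ⊆ h) ∪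
      (F.filter fun T => ¬ Heavy H r T).biUnion (fun T => H.filter fun h => T ⊆ h) := by
    intro e he
    obtain ⟨P, hP, hs⟩ := cov3 e he
    rw [mem_union, mem_biUnion, mem_biUnion]
    by_cases h : Heavy H r P
    · exact Or.inl ⟨P, mem_filter.2 ⟨hP, h⟩, mem_filter.2 ⟨he, hs⟩⟩
    · exact Or.inr ⟨P, mem_filter.2 ⟨hP, h⟩, mem_filter.2 ⟨he, hs⟩⟩
  refine (card_le_card hsub).trans ((card_union_le _ _).trans (add_le_add ?_ ?_))
  · refine (card_biUnion_le_card_mul _ _ C ?_).trans (Nat.mul_le_mul_right _ (card_le_card ?_))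
    · intro P hP
      have := card_containing H r hunif P
      rwa [k3 P (mem_filter.1 hP).1] at this
    · intro P hP
      rw [mem_filter] at hP
      exact mem_filter.2 ⟨mem_powersetCard.2 ⟨subset_univ _, k3 P hP.1⟩, hP.2⟩
  · refine (card_biUnion_le_card_mul _ _ D ?_).trans (Nat.mul_le_mul_right _
      ((card_le_card (filter_subset _ _)).trans hF))
    intro P hP
    rw [mem_filter] at hP
    exact light_bound H r hr hunif P (k3 P hP.1) hP.2

/-- the kernel system -/
def kern (r : ℕ) (X : Finset V) : Finset (Finset V) :=
  (univ.powersetCard r).filter (fun E : Finset V => 3 ≤ (E ∩ X).card)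

lemma mem_kern (r : ℕ) (X E : Finset V) : E ∈ kern r X ↔ E.card = r ∧ 3 ≤ (E ∩ X).card := by
  simp [kern, mem_powersetCard]

lemma kern_int (r : ℕ) (X : Finset V) (hX : X.card = 5) :
    ∀ a ∈ kern r X, ∀ b ∈ kern r X, (a ∩ b).Nonempty := by
  intro a ha b hb
  rw [mem_kern] at ha hb
  have h1 := card_union_add_card_inter (a ∩ X) (b ∩ X)
  have h2 := card_le_card (union_subset (inter_subset_right (s₁ := a) (s₂ := X))
    (inter_subset_right (s₁ := b) (s₂ := X)))
  have h3 : 0 < ((a ∩ X) ∩ (b ∩ X)).card := by omega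
  obtain ⟨x, hx⟩ := card_pos.1 h3
  simp only [mem_inter] at hx
  exact ⟨x, mem_inter.2 ⟨hx.1.1, hx.2.1⟩⟩

lemma kern_codeg (r : ℕ) (hr : 3 ≤ r) (hn : r + 2 ≤ Fintype.card V) (X : Finset V)
    (hX : X.card = 5) (S : Finset V) (hS : S.card = r - 1) (hh : ∃ h ∈ kern r X, S ⊆ h) :
    3 ≤ ((kern r X).filter fun h => S ⊆ h).card := by
  obtain ⟨h, hk, hs⟩ := hh
  rw [mem_kern] at hk
  have main : ∀ W : Finset V, 3 ≤ W.card → Disjoint W S →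
      (∀ w ∈ W, 3 ≤ (insert w S ∩ X).card) → 3 ≤ ((kern r X).filter fun h => S ⊆ h).card := by
    intro W hW hd hw
    refine hW.trans (card_le_card_of_injOn (fun w => insert w S) ?_ ?_)
    · intro w hwW
      rw [mem_coe] at hwW
      rw [mem_coe, mem_filter, mem_kern]
      refine ⟨⟨?_, hw w hwW⟩, subset_insert _ _⟩
      rw [card_insert_of_notMem (disjoint_left.1 hd hwW), hS]; omega
    · intro w hwW w' hwW' heq
      rw [mem_coe] at hwW
      have : w ∈ insert w' S := by
        have h : w ∈ insert w S := mem_insert_self _ _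
        simp only at heq
        rwa [heq] at h
      rw [mem_insert] at this
      exact this.resolve_right (disjoint_left.1 hd hwW)
  by_cases h3 : 3 ≤ (S ∩ X).card
  · refine main Sᶜ (by rw [card_compl]; omega) disjoint_compl_left ?_
    intro w _
    exact h3.trans (card_le_card (inter_subset_inter_right (subset_insert _ _)))
  · have h2 : 2 ≤ (S ∩ X).card := by
      have e1 : h ∩ X ⊆ (h \ S) ∪ (S ∩ X) := by
        intro x; simp only [mem_inter, mem_union, mem_sdiff]; tauto
      have e2 := card_le_card e1
      have e3 := card_union_le (h \ S) (S ∩ X)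
      have e4 := card_sdiff_of_subset hs
      omega
    refine main (X \ S) ?_ sdiff_disjoint ?_
    · have := card_sdiff_add_card_inter X S
      rw [inter_comm] at this
      omega
    · intro w hw
      rw [mem_sdiff] at hw
      rw [insert_inter_of_mem hw.1, card_insert_of_notMem (by rw [mem_inter]; tauto)]
      omega

lemma kern_card (r : ℕ) (hr : 3 ≤ r) (X : Finset V) (hX : X.card = 5) :
    10 * (Fintype.card V - 5).choose (r - 3) ≤ (kern r X).card := by
  have h1 : ((X.powersetCard 3) ×ˢ (Xᶜ.powersetCard (r - 3))).card =
      10 * (Fintype.card V - 5).choose (r - 3) := by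
    rw [card_product, card_powersetCard, card_powersetCard, card_compl, hX]
    rfl
  rw [← h1]
  have sep : ∀ P Q : Finset V, P ⊆ X → Q ⊆ Xᶜ → (P ∪ Q) ∩ X = P ∧ (P ∪ Q) \ X = Q := by
    intro P Q hP hQ
    constructor
    · ext x
      have := @hP x
      have := @hQ x
      simp only [mem_inter, mem_union, mem_compl] at *
      tauto
    · ext x
      have := @hP x
      have := @hQ x
      simp only [mem_sdiff, mem_union, mem_compl] at *
      tauto
  refine card_le_card_of_injOn (fun p => p.1 ∪ p.2) ?_ ?_
  · rintro ⟨P, Q⟩ hPQ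
    rw [mem_coe, mem_product, mem_powersetCard, mem_powersetCard] at hPQ
    rw [mem_coe, mem_kern]
    simp only at hPQ ⊢
    rw [(sep P Q hPQ.1.1 hPQ.2.1).1, card_union_of_disjoint
      (disjoint_of_subset_left hPQ.1.1 (disjoint_of_subset_right hPQ.2.1 disjoint_compl_right))]
    omega
  · rintro ⟨P, Q⟩ hPQ ⟨P', Q'⟩ hPQ' heq
    rw [mem_coe, mem_product, mem_powersetCard, mem_powersetCard] at hPQ hPQ'
    simp only at hPQ hPQ' heq
    have s1 := sep P Q hPQ.1.1 hPQ.2.1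
    have s2 := sep P' Q' hPQ'.1.1 hPQ'.2.1
    rw [heq] at s1
    rw [Prod.mk.injEq]
    exact ⟨s1.1.symm.trans s2.1, s1.2.symm.trans s2.2⟩

lemma D4_mul (r n : ℕ) (hr : 3 ≤ r) (hn : 4 ≤ n) :
    (n - 3) * D4 r n = (n - 3).choose (r - 3) * (r - 3) := by
  unfold D4
  split_ifs with h
  · subst h; simp
  · obtain ⟨k, rfl⟩ : ∃ k, r = k + 4 := ⟨r - 4, by omega⟩
    obtain ⟨m, rfl⟩ : ∃ m, n = m + 4 := ⟨n - 4, by omega⟩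
    exact Nat.add_one_mul_choose_eq m k

lemma choose_le (r n : ℕ) (hr : 3 ≤ r) (hn : 5 ≤ n) :
    (n - 3).choose (r - 3) ≤ (n - 5).choose (r - 3) + 2 * D4 r n := by
  unfold D4
  split_ifs with h
  · subst h; simp
  · obtain ⟨k, rfl⟩ : ∃ k, r = k + 4 := ⟨r - 4, by omega⟩
    obtain ⟨m, rfl⟩ : ∃ m, n = m + 5 := ⟨n - 5, by omega⟩
    have e1 : (m + 2).choose (k + 1) = (m + 1).choose k + (m + 1).choose (k + 1) :=
      Nat.choose_succ_succ _ _
    have e2 : (m + 1).choose (k + 1) = m.choose k + m.choose (k + 1) := Nat.choose_succ_succ _ _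
    have e3 : m.choose k ≤ (m + 1).choose k := Nat.choose_le_choose k (by omega)
    show (m + 2).choose (k + 1) ≤ m.choose (k + 1) + 2 * (m + 1).choose k
    omega

lemma numeric (r n A K Hc C C5 D : ℕ) (hr : 3 ≤ r) (hn : 2 * r ^ 5 ≤ n) (hC : 0 < C)
    (h1 : (n - 3) * D = C * (r - 3)) (h2 : C ≤ C5 + 2 * D) (h3 : 10 * C5 ≤ K) (h4 : K ≤ Hc)
    (h5 : Hc ≤ A * C + r ^ 3 * (2 * r * D)) : 10 ≤ A := by
  by_contra hA
  have hA9 : A * C ≤ 9 * C := Nat.mul_le_mul_right _ (by omega)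
  have h6 : C ≤ (2 * r ^ 4 + 20) * D := by
    have : r ^ 3 * (2 * r * D) = 2 * r ^ 4 * D := by ring
    nlinarith
  have h7 : (n - 3) * C ≤ ((2 * r ^ 4 + 20) * (r - 3)) * C := by
    calc (n - 3) * C ≤ (n - 3) * ((2 * r ^ 4 + 20) * D) := Nat.mul_le_mul_left _ h6
      _ = (2 * r ^ 4 + 20) * ((n - 3) * D) := by ring
      _ = _ := by rw [h1]; ring
  have h8 := Nat.le_of_mul_le_mul_right h7 hC
  obtain ⟨k, rfl⟩ : ∃ k, r = k + 3 := ⟨r - 3, by omega⟩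
  have h9 : n ≤ (2 * (k + 3) ^ 4 + 20) * k + 3 := by
    have : k + 3 - 3 = k := by omega
    rw [this] at h8; omega
  have h10 : 2 * (k + 3) ^ 5 = 2 * (k + 3) ^ 4 * k + 6 * (k + 3) ^ 4 := by ring
  have h11 : 6 * (k + 3) ^ 4 = 6 * (k + 3) ^ 3 * k + 18 * (k + 3) ^ 3 := by ring
  have h12 : 27 ≤ (k + 3) ^ 3 := by
    calc 27 = 3 ^ 3 := by norm_num
      _ ≤ _ := Nat.pow_le_pow_left (by omega) 3
  nlinarith [Nat.mul_le_mul_right k h12]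

end Aux


/-- For r ≥ 3 and n ≥ 2r⁵, a maximum-size intersecting r-uniform n-vertex hypergraph
with minimum positive co-degree at least 3 is a 3-kernel system. -/
theorem stmt_11 {V : Type*} [Fintype V] [DecidableEq V] (r n : ℕ)
    (hr : 3 ≤ r) (hn : Fintype.card V = n) (hn2 : 2 * r ^ 5 ≤ n)
    (H : Finset (Finset V))
    (hunif : ∀ h ∈ H, h.card = r)
    (hint : ∀ a ∈ H, ∀ b ∈ H, (a ∩ b).Nonempty)
    (hcodeg : ∀ S : Finset V, S.card = r - 1 → (∃ h ∈ H, S ⊆ h) →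
      3 ≤ (H.filter fun h => S ⊆ h).card)
    (hmax : ∀ H' : Finset (Finset V),
      (∀ h ∈ H', h.card = r) →
      (∀ a ∈ H', ∀ b ∈ H', (a ∩ b).Nonempty) →
      (∀ S : Finset V, S.card = r - 1 → (∃ h ∈ H', S ⊆ h) →
        3 ≤ (H'.filter fun h => S ⊆ h).card) →
      H'.card ≤ H.card) :
    ∃ X : Finset V, X.card = 5 ∧
      H = (Finset.univ.powersetCard r).filter (fun E : Finset V => 3 ≤ (E ∩ X).card) := by
  classical
  have hr5 : 3 ^ 4 * r ≤ r ^ 5 := by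
    calc 3 ^ 4 * r ≤ r ^ 4 * r := Nat.mul_le_mul_right _ (Nat.pow_le_pow_left hr 4)
      _ = r ^ 5 := by ring
  have hn0 : r + 5 ≤ n := by omega
  have hex := exch_of_codeg r H hr hunif hcodeg
  obtain ⟨X₀, -, hX₀⟩ := Finset.exists_subset_card_eq
    (s := (Finset.univ : Finset V)) (n := 5) (by rw [Finset.card_univ]; omega)
  have hK : ∀ X : Finset V, X.card = 5 → (kern r X).card ≤ H.card := fun X hX =>
    hmax (kern r X) (fun h hh => ((mem_kern r X h).1 hh).1) (kern_int r X hX)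
      (fun S hS hh => kern_codeg r hr (by omega) X hX S hS hh)
  have hkc := kern_card r hr X₀ hX₀
  have hpos5 : 0 < (Fintype.card V - 5).choose (r - 3) := Nat.choose_pos (by omega)
  have hne : H.Nonempty := Finset.card_pos.1 (by have := hK X₀ hX₀; omega)
  have hub := upper_bound H r hr hne hunif hint hex
  have h10 := numeric r n _ _ _ _ _ (D4 r n) hr hn2
    (Nat.choose_pos (n := Fintype.card V - 3) (k := r - 3) (by omega))
    (by rw [hn]; exact D4_mul r n hr (by omega)) (by rw [hn]; exact choose_le r n hr (by omega))
    (by rw [← hn]; exact hkc) (hK X₀ hX₀) (by rw [hn] at hub ⊢; exact hub)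
  set A := (Finset.univ.powersetCard 3).filter fun T : Finset V => Heavy H r T with hA
  have memA : ∀ T, T ∈ A ↔ T.card = 3 ∧ Heavy H r T := by
    intro T; simp [hA, Finset.mem_powersetCard]
  obtain ⟨X, hX, hXe⟩ := triple_system A (fun T hT => ((memA T).1 hT).1)
    (fun T hT T' hT' => heavy_inter H r T T' hr hunif hint ((memA T').1 hT').1
      ((memA T).1 hT).2 ((memA T').1 hT').2)
    (fun T hT g₁ h₁ g₂ h₂ c e₁ e₂ => heavy_Q H r T g₁ g₂ c hr hunif hint hex
      ((memA g₁).1 h₁).1 ((memA g₂).1 h₂).1 ((memA T).1 hT).2 ((memA g₁).1 h₁).2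
      ((memA g₂).1 h₂).2 e₁ e₂)
    (fun a b hab => by
      by_contra hcon
      obtain ⟨Y, hYs, hY⟩ := Finset.exists_subset_card_eq (n := 5) (Nat.lt_of_not_le hcon)
      refine no_sunflower H r hr hunif hint hex a b hab Y hY fun x hx => ?_
      have := (Finset.mem_filter.1 (hYs hx)).2
      exact ⟨this.1, this.2.1, ((memA _).1 this.2.2).2⟩) h10
  refine ⟨X, hX, ?_⟩
  refine Finset.eq_of_subset_of_card_le ?_ (hK X hX)
  intro e he
  have := (mem_kern r X e).2 ⟨hunif e he, hXe e fun T hT =>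
    heavy_transversal H r T hunif hint ((memA T).1 hT).2 e he⟩
  exact this
end

section
/- For fixed r ≥ k ≥ 1 and n sufficiently large, every intersecting r-uniform n-vertex hypergraph H with minimum positive co-degree at least k satisfies |E(H)| ≤ Σ_{i=k}^{min(r,2k-1)} C(2k-1,i)·C(n-2k+1, r-i), with equality if and only if H is a k-kernel system. -/
section AuxPart
open Finset

/-- co-degree shifting: a transversal meets some edge in few points -/
lemma aux_shift {α : Type*} [DecidableEq α] (r k : ℕ) (H : Finset (Finset α))
    (hr : ∀ h ∈ H, h.card = r)
    (hd : ∀ E ∈ H, ∀ x ∈ E, k ≤ (H.filter fun h => E.erase x ⊆ h).card)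
    (T : Finset α) (hT : ∀ E ∈ H, (E ∩ T).Nonempty) (hne : H.Nonempty) :
    ∃ E ∈ H, (E ∩ T).card + k ≤ T.card + 1 := by
  obtain ⟨E, hE, hmin⟩ := H.exists_min_image (fun E => (E ∩ T).card) hne
  refine ⟨E, hE, ?_⟩
  obtain ⟨x, hx⟩ := hT E hE
  rw [mem_inter] at hx
  have hk := hd E hE x hx.1
  have hsub : (H.filter fun h => E.erase x ⊆ h) ⊆ (T \ E.erase x).image (fun y => insert y (E.erase x)) := by
    intro h hh
    rw [mem_filter] at hh
    have hc : (E.erase x).card + 1 = h.card := by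
      rw [card_erase_add_one hx.1, hr E hE, hr h hh.1]
    obtain ⟨y, hy⟩ : ∃ y, h \ E.erase x = {y} := by
      rw [← card_eq_one, card_sdiff_of_subset hh.2]; omega
    have hyh : y ∈ h \ E.erase x := by rw [hy]; simp
    have hh2 : insert y (E.erase x) = h := by
      rw [insert_eq, ← hy, sdiff_union_of_subset hh.2]
    rw [mem_sdiff] at hyh
    rw [mem_image]
    refine ⟨y, ?_, hh2⟩
    rw [mem_sdiff]
    refine ⟨?_, hyh.2⟩
    by_contra hyT
    have h1 := hmin h hh.1
    have h2 : h ∩ T = (E ∩ T).erase x := by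
      rw [← hh2, insert_inter_of_notMem hyT, erase_inter]
    simp only [h2] at h1
    have := card_erase_lt_of_mem (mem_inter.2 hx)
    omega
  have h1 := (card_le_card hsub).trans card_image_le
  have h2 : (T \ E.erase x).card + (T ∩ E.erase x).card = T.card := card_sdiff_add_card_inter _ _
  have h3 : T ∩ E.erase x = (E ∩ T).erase x := by
    rw [inter_comm, erase_inter]
  have h4 := card_erase_add_one (mem_inter.2 hx)
  rw [h3] at h2
  omega

/-- for each `A` in a `k`-uniform family there is a Bollobas partner -/
lemma aux_partner {α : Type*} [DecidableEq α] (k : ℕ) (F : Finset (Finset α))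
    (hr : ∀ h ∈ F, h.card = k)
    (hi : ∀ a ∈ F, ∀ b ∈ F, (a ∩ b).Nonempty)
    (hd : ∀ E ∈ F, ∀ x ∈ E, k ≤ (F.filter fun h => E.erase x ⊆ h).card)
    (A : Finset α) (hA : A ∈ F) :
    ∃ S : Finset α, S.card + 1 = k ∧ Disjoint A S ∧ ∀ B ∈ F, B ≠ A → ¬ Disjoint B S := by
  obtain ⟨E, hE, hc⟩ := aux_shift k k F hr hd A (fun E hE => hi E hE A hA) ⟨A, hA⟩
  rw [hr A hA] at hc
  have h1 : (E ∩ A).card = 1 := by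
    have := card_pos.2 (hi E hE A hA); omega
  obtain ⟨x, hx⟩ := card_eq_one.1 h1
  have hxE : x ∈ E ∧ x ∈ A := by rw [← mem_inter, hx]; simp
  have hdis : Disjoint A (E.erase x) := by
    rw [disjoint_left]
    intro y hy hy2
    rw [mem_erase] at hy2
    have : y ∈ E ∩ A := mem_inter.2 ⟨hy2.2, hy⟩
    rw [hx, mem_singleton] at this
    exact hy2.1 this
  refine ⟨E.erase x, ?_, hdis, ?_⟩
  · rw [card_erase_add_one hxE.1, hr E hE]
  have hsub : (F.filter fun h => E.erase x ⊆ h) ⊆ A.image (fun y => insert y (E.erase x)) := by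
    intro h hh
    rw [mem_filter] at hh
    have hc : (E.erase x).card + 1 = h.card := by
      rw [card_erase_add_one hxE.1, hr E hE, hr h hh.1]
    obtain ⟨y, hy⟩ : ∃ y, h \ E.erase x = {y} := by
      rw [← card_eq_one, card_sdiff_of_subset hh.2]; omega
    have hh2 : insert y (E.erase x) = h := by
      rw [insert_eq, ← hy, sdiff_union_of_subset hh.2]
    rw [mem_image]
    refine ⟨y, ?_, hh2⟩
    obtain ⟨z, hz⟩ := hi h hh.1 A hA
    rw [mem_inter, ← hh2, mem_insert] at hz
    rcases hz.1 with h | h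
    · rw [← h]; exact hz.2
    · exact absurd h (disjoint_left.1 hdis hz.2)
  have heq := eq_of_subset_of_card_le hsub
    (card_image_le.trans ((hr A hA).le.trans (hd E hE x hxE.1)))
  intro B hB hBA hBS
  apply hBA
  symm
  apply eq_of_subset_of_card_le _ (by rw [hr A hA, hr B hB])
  intro y hy
  have : insert y (E.erase x) ∈ F := by
    have : insert y (E.erase x) ∈ A.image (fun y => insert y (E.erase x)) := mem_image_of_mem _ hy
    rw [← heq, mem_filter] at this
    exact this.1
  obtain ⟨z, hz⟩ := hi _ this B hB
  rw [mem_inter, mem_insert] at hz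
  rcases hz.1 with h | h
  · rw [← h]; exact hz.2
  · exact absurd h (disjoint_left.1 hBS hz.2)

/-- weight -/
noncomputable def auxG {α : Type*} [DecidableEq α] (F : Finset (Finset α)) (S : Finset α → Finset α)
    (U : Finset α) : ℚ :=
  ∑ A ∈ F.filter (fun A => A ⊆ U), (1 : ℚ) / ((A.card + (S A ∩ U).card).choose A.card)

lemma aux_w (a b : ℕ) : ((b:ℚ) + 1) * (1 / ((a + b).choose a)) = (a + (b + 1)) * (1 / ((a + (b+1)).choose a)) := by
  have h1 : ((a + b).choose a : ℚ) ≠ 0 := by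
    have := Nat.choose_pos (Nat.le_add_right a b); positivity
  have h2 : ((a + (b+1)).choose a : ℚ) ≠ 0 := by
    have := Nat.choose_pos (Nat.le_add_right a (b+1)); positivity
  have h3 := Nat.choose_mul_succ_eq (a + b) a
  have h4 : a + b + 1 - a = b + 1 := by omega
  rw [h4] at h3
  have h5 : ((a + b).choose a : ℚ) * (a + b + 1) = (a + (b+1)).choose a * (b+1) := by
    exact_mod_cast h3
  field_simp
  linarith

lemma auxG_avg {α : Type*} [DecidableEq α] (F : Finset (Finset α)) (S : Finset α → Finset α)
    (hS : ∀ A ∈ F, Disjoint A (S A))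
    (U : Finset α) (hU : ∀ A ∈ F, A ⊆ U → (S A ∩ U).Nonempty) :
    ∑ v ∈ U, auxG F S (U.erase v) = U.card * auxG F S U := by
  unfold auxG
  have : ∀ v ∈ U, ∑ A ∈ F.filter (fun A => A ⊆ U.erase v), (1 : ℚ) / ((A.card + (S A ∩ U.erase v).card).choose A.card)
    = ∑ A ∈ F.filter (fun A => A ⊆ U), if v ∈ A then 0 else (1 : ℚ) / ((A.card + (S A ∩ U.erase v).card).choose A.card) := by
    intro v hv
    have hf := sum_filter (s := F.filter (fun A => A ⊆ U)) (fun A => v ∉ A)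
      (fun A => (1 : ℚ) / ((A.card + (S A ∩ U.erase v).card).choose A.card))
    simp only [ite_not] at hf
    rw [← hf, filter_filter]
    apply sum_congr _ (fun _ _ => rfl)
    ext A
    simp only [mem_filter, subset_erase]
  rw [sum_congr rfl this, sum_comm, mul_sum]
  apply sum_congr rfl
  intro A hA
  rw [mem_filter] at hA
  obtain ⟨b, hb⟩ : ∃ b, (S A ∩ U).card = b + 1 := by
    have := card_pos.2 (hU A hA.1 hA.2)
    exact ⟨_, (Nat.sub_add_cancel this).symm⟩
  have hdis := hS A hA.1
  have hU2 : U = A ∪ ((S A ∩ U) ∪ (U \ (A ∪ S A))) := by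
    ext x; have := @hA.2 x; simp only [mem_union, mem_inter, mem_sdiff]; tauto
  have d1 : Disjoint (S A ∩ U) (U \ (A ∪ S A)) := by
    rw [disjoint_left]; intro x; simp only [mem_union, mem_inter, mem_sdiff]; tauto
  have d2 : Disjoint A ((S A ∩ U) ∪ (U \ (A ∪ S A))) := by
    rw [disjoint_left] at *; intro x hx; have := hdis hx; simp only [mem_union, mem_inter, mem_sdiff]; tauto
  have e1 : ∑ v ∈ A, (if v ∈ A then 0 else (1 : ℚ) / ((A.card + (S A ∩ U.erase v).card).choose A.card)) = 0 :=
    sum_eq_zero (fun v hv => if_pos hv)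
  have e2 : ∑ v ∈ S A ∩ U, (if v ∈ A then 0 else (1 : ℚ) / ((A.card + (S A ∩ U.erase v).card).choose A.card))
     = (b + 1) * (1 / ((A.card + b).choose A.card)) := by
    rw [sum_congr rfl (g := fun _ => (1:ℚ) / ((A.card + b).choose A.card)), sum_const, hb, nsmul_eq_mul]
    · push_cast; rfl
    intro v hv
    rw [if_neg (fun h => disjoint_left.1 hdis h (mem_inter.1 hv).1), inter_erase, card_erase_of_mem hv, hb]
    rfl
  have e3 : ∑ v ∈ U \ (A ∪ S A), (if v ∈ A then 0 else (1 : ℚ) / ((A.card + (S A ∩ U.erase v).card).choose A.card))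
     = (U \ (A ∪ S A)).card * (1 / ((A.card + (b+1)).choose A.card)) := by
    rw [sum_congr rfl (g := fun _ => (1:ℚ) / ((A.card + (b+1)).choose A.card)), sum_const, nsmul_eq_mul]
    intro v hv
    simp only [mem_sdiff, mem_union, not_or] at hv
    rw [if_neg hv.2.1, inter_erase, erase_eq_of_notMem (fun h => hv.2.2 (mem_inter.1 h).1), hb]
  have hcard : (U.card : ℚ) = A.card + ((b + 1) + (U \ (A ∪ S A)).card) := by
    have := congrArg card hU2
    rw [card_union_of_disjoint d2, card_union_of_disjoint d1, hb] at this
    exact_mod_cast this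
  have hsum := sum_union (f := fun v => (if v ∈ A then 0 else (1 : ℚ) / ((A.card + (S A ∩ U.erase v).card).choose A.card))) d2
  rw [sum_union d1, ← hU2, e1, e2, e3, aux_w] at hsum
  rw [hsum, hcard, hb]
  ring

lemma auxG_deg {α : Type*} [DecidableEq α] (F : Finset (Finset α)) (S : Finset α → Finset α)
    (hS2 : ∀ A ∈ F, ∀ B ∈ F, B ≠ A → ¬ Disjoint B (S A))
    (U : Finset α) (A : Finset α) (hA : A ∈ F) (hAU : A ⊆ U) (he : S A ∩ U = ∅) :
    F.filter (fun A => A ⊆ U) = {A} := by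
  ext B
  simp only [mem_filter, mem_singleton]
  constructor
  · rintro ⟨hB, hBU⟩
    by_contra hne
    apply hS2 A hA B hB hne
    rw [disjoint_left]
    intro x hx hx2
    have : x ∈ S A ∩ U := mem_inter.2 ⟨hx2, hBU hx⟩
    simp [he] at this
  · rintro rfl; exact ⟨hA, hAU⟩

lemma auxG_le {α : Type*} [DecidableEq α] (F : Finset (Finset α)) (S : Finset α → Finset α)
    (hS : ∀ A ∈ F, Disjoint A (S A)) 
    (hS2 : ∀ A ∈ F, ∀ B ∈ F, B ≠ A → ¬ Disjoint B (S A)) (U : Finset α) : auxG F S U ≤ 1 := by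
  induction U using Finset.strongInduction with
  | H U ih =>
    by_cases h : ∀ A ∈ F, A ⊆ U → (S A ∩ U).Nonempty
    · rcases U.eq_empty_or_nonempty with rfl | hne
      · unfold auxG
        rw [filter_false_of_mem, sum_empty]; · norm_num
        intro A hA hA2
        simpa using h A hA hA2
      · have h1 := auxG_avg F S hS U h
        have h2 : ∑ v ∈ U, auxG F S (U.erase v) ≤ ∑ v ∈ U, 1 :=
          sum_le_sum fun v hv => ih _ (erase_ssubset hv)
        rw [h1] at h2
        have : (0:ℚ) < U.card := by exact_mod_cast card_pos.2 hne
        simp only [sum_const, nsmul_eq_mul] at h2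
        exact le_of_mul_le_mul_left h2 this
    · push Not at h
      obtain ⟨A, hA, hAU, he⟩ := h
      unfold auxG
      rw [auxG_deg F S hS2 U A hA hAU he, sum_singleton, he]
      simp

lemma auxG_eq {α : Type*} [DecidableEq α] [Fintype α] (F : Finset (Finset α)) (S : Finset α → Finset α)
    (hS : ∀ A ∈ F, Disjoint A (S A)) 
    (hS2 : ∀ A ∈ F, ∀ B ∈ F, B ≠ A → ¬ Disjoint B (S A)) (h1 : auxG F S univ = 1)
    (A : Finset α) (hA : A ∈ F) (s : α) (hs : s ∈ S A) (D : Finset α) (hD : Disjoint D (insert s A)) :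
    auxG F S Dᶜ = 1 := by
  induction D using Finset.induction_on with
  | empty => simpa using h1
  | insert v D hv ih =>
    rw [disjoint_insert_left] at hD
    have ih := ih hD.2
    have hsub : insert s A ⊆ Dᶜ := by
      rw [subset_compl_iff_disjoint_left]; exact hD.2
    have havg := auxG_avg F S hS Dᶜ (by
      intro B hB hBD
      rw [nonempty_iff_ne_empty]
      intro he
      have := auxG_deg F S hS2 _ B hB hBD he
      have hA2 : A ∈ F.filter (fun A => A ⊆ Dᶜ) := mem_filter.2 ⟨hA, (subset_insert _ _).trans hsub⟩
      rw [this, mem_singleton] at hA2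
      subst hA2
      have : s ∈ S A ∩ Dᶜ := mem_inter.2 ⟨hs, hsub (mem_insert_self _ _)⟩
      simp [he] at this)
    rw [ih] at havg
    have hle : ∀ v ∈ Dᶜ, auxG F S (Dᶜ.erase v) ≤ 1 := fun v _ => auxG_le F S hS hS2 _
    have := (sum_eq_sum_iff_of_le hle).1 (by rw [havg]; simp)
    have := this v (by simpa using hv)
    rwa [compl_insert]

lemma aux_bollobas {α : Type*} [DecidableEq α] [Fintype α] (k : ℕ) (hk : 1 ≤ k)
    (F : Finset (Finset α)) (S : Finset α → Finset α)
    (hr : ∀ A ∈ F, A.card = k) (hSc : ∀ A ∈ F, (S A).card + 1 = k)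
    (hS : ∀ A ∈ F, Disjoint A (S A)) 
    (hS2 : ∀ A ∈ F, ∀ B ∈ F, B ≠ A → ¬ Disjoint B (S A)) 
    (hF : (2 * k - 1).choose k ≤ F.card) :
    ∃ X : Finset α, X.card = 2 * k - 1 ∧ ∀ C ⊆ X, C.card = k → C ∈ F := by
  have hpos : 0 < (2 * k - 1).choose k := Nat.choose_pos (by omega)
  have hg : auxG F S univ = F.card * (1 / ((2 * k - 1).choose k)) := by
    unfold auxG
    rw [filter_true_of_mem (fun _ _ => subset_univ _), ← nsmul_eq_mul, ← sum_const]
    apply sum_congr rfl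
    intro A hA
    have h := hSc A hA
    rw [inter_univ, hr A hA, show k + (S A).card = 2 * k - 1 by omega]
  have hg1 : auxG F S univ = 1 := by
    apply le_antisymm (auxG_le F S hS hS2 _)
    rw [hg, mul_one_div, le_div_iff₀ (by exact_mod_cast hpos), one_mul]
    exact_mod_cast hF
  -- exchange
  have hex : ∀ A ∈ F, ∀ s ∈ S A, ∀ a ∈ A, insert s (A.erase a) ∈ F := by
    intro A hA s hs a ha
    have hsA : s ∉ A := fun h => disjoint_left.1 (hS A hA) h hs
    have h1 := auxG_eq F S hS hS2 hg1 A hA s hs (insert s A)ᶜ disjoint_compl_left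
    rw [compl_compl] at h1
    unfold auxG at h1
    have hw : ∀ C ∈ F.filter (fun C => C ⊆ insert s A), 
        (1 : ℚ) / ((C.card + (S C ∩ insert s A).card).choose C.card) = 1 / (k + 1) := by
      intro C hC
      rw [mem_filter] at hC
      have hc : (S C ∩ insert s A).card = 1 := by
        apply le_antisymm
        · have e1 : Disjoint C (S C ∩ insert s A) := (hS C hC.1).mono_right inter_subset_left
          have := card_le_card (union_subset hC.2 (inter_subset_right : S C ∩ insert s A ⊆ _))
          rw [card_union_of_disjoint e1, card_insert_of_notMem hsA, hr A hA, hr C hC.1] at this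
          omega
        · rw [Nat.one_le_iff_ne_zero, ← Nat.pos_iff_ne_zero, card_pos]
          by_cases hCA : A = C
          · subst hCA; exact ⟨s, mem_inter.2 ⟨hs, mem_insert_self _ _⟩⟩
          · have := hS2 C hC.1 A hA hCA
            rw [not_disjoint_iff] at this
            obtain ⟨z, hz, hz2⟩ := this
            exact ⟨z, mem_inter.2 ⟨hz2, mem_insert_of_mem hz⟩⟩
      rw [hc, hr C hC.1]
      simp
    rw [sum_congr rfl hw, sum_const, nsmul_eq_mul] at h1
    have hcard : (F.filter (fun C => C ⊆ insert s A)).card = k + 1 := by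
      have : ((k:ℚ) + 1) ≠ 0 := by positivity
      field_simp at h1
      exact_mod_cast h1
    have hsub : F.filter (fun C => C ⊆ insert s A) ⊆ powersetCard k (insert s A) := by
      intro C hC
      rw [mem_filter] at hC
      exact mem_powersetCard.2 ⟨hC.2, hr C hC.1⟩
    have heq := eq_of_subset_of_card_le hsub (by
      rw [card_powersetCard, card_insert_of_notMem hsA, hr A hA, hcard]; simp)
    have : insert s (A.erase a) ∈ powersetCard k (insert s A) := by
      rw [mem_powersetCard]
      refine ⟨insert_subset_insert _ (erase_subset _ _), ?_⟩
      rw [card_insert_of_notMem (fun h => hsA (mem_of_mem_erase h)), card_erase_add_one ha, hr A hA]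
    rw [← heq] at this
    exact (mem_filter.1 this).1
  have hex2 : ∀ A ∈ F, ∀ s ∈ S A, ∀ a ∈ A, S (insert s (A.erase a)) = insert a ((S A).erase s) := by
    intro A hA s hs a ha
    have hF' := hex A hA s hs a ha
    have hsA : s ∉ A := fun h => disjoint_left.1 (hS A hA) h hs
    have haS : a ∉ S A := disjoint_left.1 (hS A hA) ha
    have hd' := hS _ hF'
    symm
    apply eq_of_subset_of_card_le
    · rw [insert_subset_iff]
      constructor
      · have := hS2 _ hF' A hA (by intro h; apply hsA; rw [h]; exact mem_insert_self _ _)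
        rw [not_disjoint_iff] at this
        obtain ⟨z, hz, hz2⟩ := this
        by_cases hza : z = a
        · exact hza ▸ hz2
        · exact absurd hz2 (disjoint_left.1 hd' (mem_insert_of_mem (mem_erase.2 ⟨hza, hz⟩)))
      · intro t ht
        rw [mem_erase] at ht
        have htF := hex A hA t ht.2 a ha
        have := hS2 _ hF' _ htF (by
          intro h
          have : t ∈ insert s (A.erase a) := by rw [← h]; exact mem_insert_self _ _
          rw [mem_insert, mem_erase] at this
          rcases this with h | h
          · exact ht.1 h
          · exact disjoint_left.1 (hS A hA) h.2 ht.2)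
        rw [not_disjoint_iff] at this
        obtain ⟨z, hz, hz2⟩ := this
        rw [mem_insert] at hz
        rcases hz with h | h
        · rwa [← h]
        · exact absurd hz2 (disjoint_left.1 hd' (mem_insert_of_mem h))
    · have e1 := hSc _ hF'
      have e2 := hSc A hA
      rw [card_insert_of_notMem (fun h => haS (mem_of_mem_erase h)), card_erase_add_one hs]
      omega
  obtain ⟨A0, hA0⟩ : F.Nonempty := card_pos.1 (by omega)
  refine ⟨A0 ∪ S A0, ?_, ?_⟩
  · rw [card_union_of_disjoint (hS A0 hA0), hr A0 hA0]
    have := hSc A0 hA0; omega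
  have key : ∀ m : ℕ, ∀ C ⊆ A0 ∪ S A0, C.card = k → (C \ A0).card = m → C ∈ F ∧ S C = (A0 ∪ S A0) \ C := by
    intro m
    induction m with
    | zero =>
      intro C _ hC h0
      have : C = A0 := by
        apply eq_of_subset_of_card_le
        · rw [← sdiff_eq_empty_iff_subset, ← card_eq_zero]; exact h0
        · rw [hC, hr A0 hA0]
      subst this
      refine ⟨hA0, ?_⟩
      rw [union_sdiff_cancel_left (hS C hA0)]
    | succ m ih =>
      intro C hCX hC hm
      obtain ⟨s, hs⟩ : (C \ A0).Nonempty := card_pos.1 (by omega)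
      have hsm := hs
      rw [mem_sdiff] at hs
      obtain ⟨a, ha⟩ : (A0 \ C).Nonempty := by
        rw [nonempty_iff_ne_empty, Ne, sdiff_eq_empty_iff_subset]
        intro h
        have := eq_of_subset_of_card_le h (by rw [hC, hr A0 hA0])
        rw [this] at hs; exact hs.2 hs.1
      rw [mem_sdiff] at ha
      have hne : s ≠ a := fun h => ha.2 (h ▸ hs.1)
      have haC : a ∉ C.erase s := fun h => ha.2 (mem_of_mem_erase h)
      obtain ⟨i1, i2⟩ := ih (insert a (C.erase s))
        (insert_subset (mem_union_left _ ha.1) ((erase_subset _ _).trans hCX))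
        (by rw [card_insert_of_notMem haC, card_erase_add_one hs.1, hC])
        (by rw [insert_sdiff_of_mem _ ha.1, erase_sdiff_comm, card_erase_of_mem hsm, hm]; rfl)
      have hsS : s ∈ S (insert a (C.erase s)) := by
        rw [i2, mem_sdiff]
        refine ⟨hCX hs.1, ?_⟩
        simp [hne]
      have hCe : insert s ((insert a (C.erase s)).erase a) = C := by
        rw [erase_insert haC, insert_erase hs.1]
      have j1 := hex _ i1 s hsS a (mem_insert_self _ _)
      have j2 := hex2 _ i1 s hsS a (mem_insert_self _ _)
      rw [hCe] at j1 j2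
      refine ⟨j1, ?_⟩
      rw [j2, i2]
      ext z
      have hsX := hCX hs.1
      have haX : a ∈ A0 ∪ S A0 := mem_union_left _ ha.1
      simp only [mem_insert, mem_erase, mem_sdiff]
      by_cases hza : z = a
      · subst hza; simp [haX, ha.2]
      · by_cases hzs : z = s
        · subst hzs; simp [hza, hs.1]
        · simp [hza, hzs]
  intro C hCX hC
  exact (key _ C hCX hC rfl).1

/-- bounded kernel -/
lemma aux_kernel (r m : ℕ) : ∃ c : ℕ, ∀ n : ℕ, ∀ H : Finset (Finset (Fin n)),
    (∀ h ∈ H, h.card = r) → (∀ a ∈ H, ∀ b ∈ H, (a ∩ b).Nonempty) →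
    ∃ V : Finset (Fin n), V.card ≤ c ∧ ∀ E ∈ H, m ≤ (E ∩ V).card ∨ ∀ E' ∈ H, (E' ∩ (E ∩ V)).Nonempty := by
  classical
  induction m with
  | zero => exact ⟨0, fun n H _ _ => ⟨∅, by simp, fun E _ => Or.inl (Nat.zero_le _)⟩⟩
  | succ m ih =>
    obtain ⟨c, hc⟩ := ih
    refine ⟨c + 2 ^ c * r, fun n H hr hi => ?_⟩
    obtain ⟨V, hV, hE⟩ := hc n H hr hi
    have : ∀ P : Finset (Fin n), ∃ e : Finset (Fin n), e.card ≤ r ∧ ((∃ E' ∈ H, E' ∩ P = ∅) → e ∈ H ∧ e ∩ P = ∅) := by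
      intro P
      by_cases h : ∃ E' ∈ H, E' ∩ P = ∅
      · obtain ⟨E', h1, h2⟩ := h
        exact ⟨E', (hr _ h1).le, fun _ => ⟨h1, h2⟩⟩
      · exact ⟨∅, by simp, fun h' => absurd h' h⟩
    choose e he1 he2 using this
    refine ⟨V ∪ V.powerset.biUnion e, ?_, ?_⟩
    · refine (card_union_le _ _).trans (add_le_add hV ?_)
      refine (card_biUnion_le_card_mul _ _ r (fun P _ => he1 P)).trans ?_
      rw [card_powerset]
      exact Nat.mul_le_mul_right _ (Nat.pow_le_pow_right (by norm_num) hV)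
    · intro E hEH
      by_cases ht : ∀ E' ∈ H, (E' ∩ (E ∩ V)).Nonempty
      · right
        intro E' hE'
        exact (ht E' hE').mono (inter_subset_inter_left (inter_subset_inter_left subset_union_left))
      · left
        have hm := (hE E hEH).resolve_right ht
        push Not at ht
        obtain ⟨g1, g2⟩ := he2 (E ∩ V) ht
        obtain ⟨z, hz⟩ := hi E hEH _ g1
        rw [mem_inter] at hz
        have hzV : z ∉ E ∩ V := by
          intro h
          have : z ∈ e (E ∩ V) ∩ (E ∩ V) := mem_inter.2 ⟨hz.2, h⟩
          simp [g2] at this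
        have hsub : insert z (E ∩ V) ⊆ E ∩ (V ∪ V.powerset.biUnion e) := by
          rw [insert_subset_iff]
          refine ⟨mem_inter.2 ⟨hz.1, mem_union_right _ (mem_biUnion.2 ⟨E ∩ V, ?_, hz.2⟩)⟩,
            inter_subset_inter_left subset_union_left⟩
          exact mem_powerset.2 inter_subset_right
        have := card_le_card hsub
        rw [card_insert_of_notMem hzV] at this
        omega

lemma aux_asymp (M m c d : ℕ) (hM : 1 ≤ M) : ∃ n₀ : ℕ, ∀ n, n₀ ≤ n →
    (M - 1) * n.choose d + (if d = 0 then 0 else c * n.choose (d - 1)) < M * (n - m).choose d := by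
  rcases d with _ | d
  · exact ⟨0, fun n _ => by simp; omega⟩
  · refine ⟨(M * m + c) * (d+1) ^ (d+1) + (d + 1) + m + 1, fun n hn => ?_⟩
    have h1 : n.choose (d+1) ≤ (n - m).choose (d+1) + m * n.choose d := by
      have hg : ∀ m, m ≤ n → n.choose (d+1) ≤ (n - m).choose (d+1) + m * n.choose d := by
        intro m
        induction m with
        | zero => intro _; simp
        | succ m ih =>
          intro hm
          have h := ih (by omega)
          have e : n - m = (n - (m+1)) + 1 := by omega
          have h2 := Nat.choose_succ_succ (n - (m+1)) d
          rw [Nat.succ_eq_add_one, ← e] at h2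
          have h3 := Nat.choose_le_choose d (show n - (m+1) ≤ n by omega)
          rw [Nat.succ_eq_add_one] at h2
          rw [add_mul]
          omega
      exact hg m (by omega)
    have h2 : (M * m + c) * n.choose d < n.choose (d+1) := by
      have h3 := Nat.choose_succ_right_eq n d
      have hp : 0 < n.choose d := Nat.choose_pos (by omega)
      have h4 : (M * m + c) * (d + 1) < n - d := by
        have : (d + 1) ≤ (d+1)^(d+1) := Nat.le_self_pow (by omega) _
        have := Nat.mul_le_mul_left (M * m + c) this
        omega
      have h5 : (M * m + c) * n.choose d * (d+1) < n.choose (d+1) * (d+1) := by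
        rw [h3]
        calc _ = n.choose d * ((M * m + c) * (d+1)) := by ring
          _ < _ := Nat.mul_lt_mul_of_pos_left h4 hp
      exact lt_of_mul_lt_mul_right h5 (Nat.zero_le _)
    obtain ⟨M, rfl⟩ : ∃ M', M = M' + 1 := ⟨M - 1, by omega⟩
    simp only [Nat.add_sub_cancel, Nat.succ_ne_zero, if_false]
    have h6 := Nat.mul_le_mul_left (M+1) h1
    nlinarith

lemma aux_count (n r k : ℕ) (X : Finset (Fin n)) (hX : X.card = 2 * k - 1) :
    ((Finset.univ.powersetCard r).filter (fun E : Finset (Fin n) => k ≤ (E ∩ X).card)).card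
    = ∑ i ∈ Finset.Icc k (min r (2 * k - 1)),
          (2 * k - 1).choose i * (n - (2 * k - 1)).choose (r - i) := by
  rw [card_eq_sum_card_fiberwise (f := fun E => (E ∩ X).card) (t := Finset.Icc k (min r (2 * k - 1)))]
  · apply sum_congr rfl
    intro i hi
    rw [mem_Icc, le_min_iff] at hi
    have hXc : Xᶜ.card = n - (2 * k - 1) := by rw [card_compl, hX, Fintype.card_fin]
    rw [← hXc, ← hX, ← card_powersetCard, ← card_powersetCard, ← card_product]
    apply card_bij' (fun E _ => (E ∩ X, E ∩ Xᶜ)) (fun p _ => p.1 ∪ p.2)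
    · intro E hE
      simp only [mem_filter, mem_powersetCard_univ] at hE
      simp only [mem_product, mem_powersetCard]
      refine ⟨⟨inter_subset_right, hE.2⟩, inter_subset_right, ?_⟩
      have := card_inter_add_card_sdiff E X
      rw [sdiff_eq_inter_compl] at this
      omega
    · rintro ⟨P, Q⟩ hp
      simp only [mem_product, mem_powersetCard] at hp
      have hd : Disjoint P Q := by
        apply disjoint_of_subset_left hp.1.1
        rw [← subset_compl_iff_disjoint_left]; exact hp.2.1
      have e : (P ∪ Q) ∩ X = P := by
        rw [union_inter_distrib_right, inter_eq_left.2 hp.1.1]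
        have : Disjoint Q X := by rw [← subset_compl_iff_disjoint_right]; exact hp.2.1
        rw [disjoint_iff_inter_eq_empty.1 this, union_empty]
      simp only [mem_filter, mem_powersetCard_univ]
      rw [e, card_union_of_disjoint hd]
      omega
    · intro E _
      simp only [← inter_union_distrib_left, union_compl, inter_univ]
    · rintro ⟨P, Q⟩ hp
      simp only [mem_product, mem_powersetCard] at hp
      have h1 := hp.1.1
      have h2 := hp.2.1
      ext x
      · have := @h1 x; have := @h2 x
        simp only [mem_inter, mem_union, mem_compl] at *; tauto
      · have := @h1 x; have := @h2 x
        simp only [mem_inter, mem_union, mem_compl] at *; tauto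
  · intro E hE
    simp only [coe_filter, Set.mem_ofPred_eq, mem_powersetCard_univ] at hE
    simp only [coe_Icc, Set.mem_Icc, le_min_iff]
    refine ⟨hE.2, ?_, ?_⟩
    · rw [← hE.1]; exact card_le_card inter_subset_left
    · rw [← hX]; exact card_le_card inter_subset_right

lemma aux_main (r k : ℕ) (hk : 1 ≤ k) (hkr : k ≤ r) :
    ∃ n₀ : ℕ, ∀ n, n₀ ≤ n → ∀ H : Finset (Finset (Fin n)),
      (∀ h ∈ H, h.card = r) →
      (∀ a ∈ H, ∀ b ∈ H, (a ∩ b).Nonempty) →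
      (∀ S : Finset (Fin n), S.card = r - 1 → (∃ h ∈ H, S ⊆ h) →
        k ≤ (H.filter fun h => S ⊆ h).card) →
      (2 * k - 1).choose k * (n - (2 * k - 1)).choose (r - k) ≤ H.card →
      ∃ X : Finset (Fin n), X.card = 2 * k - 1 ∧ ∀ E ∈ H, k ≤ (E ∩ X).card := by
  obtain ⟨c, hc⟩ := aux_kernel r (r+1)
  have hM : 0 < (2 * k - 1).choose k := Nat.choose_pos (by omega)
  obtain ⟨n₀, hn₀⟩ := aux_asymp ((2 * k - 1).choose k) (2 * k - 1) (2 ^ c) (r - k) hM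
  refine ⟨n₀, fun n hn H hr hi hd0 hcard => ?_⟩
  have hlt := hn₀ n hn
  have hd : ∀ E ∈ H, ∀ x ∈ E, k ≤ (H.filter fun h => E.erase x ⊆ h).card := by
    intro E hE x hx
    exact hd0 _ (by rw [card_erase_of_mem hx, hr E hE]) ⟨E, hE, erase_subset _ _⟩
  obtain ⟨V, hV, hVE0⟩ := hc n H hr hi
  have hVE : ∀ E ∈ H, ∀ E' ∈ H, (E' ∩ (E ∩ V)).Nonempty := by
    intro E hE
    refine (hVE0 E hE).resolve_left ?_
    have := card_le_card (inter_subset_left : E ∩ V ⊆ E)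
    rw [hr E hE] at this
    omega
  have hVk : ∀ E ∈ H, k ≤ (E ∩ V).card := by
    intro E hE
    obtain ⟨E', hE', h⟩ := aux_shift r k H hr hd (E ∩ V) (hVE E hE) ⟨E, hE⟩
    have := card_pos.2 (hVE E hE E' hE')
    omega
  -- the edges meeting V in more than k points
  have hbig : (H.filter (fun E => ¬ (E ∩ V).card = k)).card ≤
      (if r - k = 0 then 0 else 2 ^ c * n.choose (r - k - 1)) := by
    split_ifs with h0
    · rw [Nat.le_zero, card_eq_zero, filter_eq_empty_iff]
      intro E hE
      have := card_le_card (inter_subset_left : E ∩ V ⊆ E)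
      rw [hr E hE] at this
      have := hVk E hE
      omega
    · have hsub : H.filter (fun E => ¬ (E ∩ V).card = k) ⊆
          (V.powerset ×ˢ powersetCard (r - k - 1) univ).image (fun p => p.1 ∪ p.2) := by
        intro E hE
        rw [mem_filter] at hE
        have h1 := hVk E hE.1
        obtain ⟨P, hP, hPc⟩ := exists_subset_card_eq (show k + 1 ≤ (E ∩ V).card by omega)
        rw [mem_image]
        have hPE : P ⊆ E := hP.trans inter_subset_left
        refine ⟨(P, E \ P), ?_, union_sdiff_of_subset hPE⟩
        rw [mem_product, mem_powerset, mem_powersetCard_univ, card_sdiff_of_subset hPE, hr E hE.1, hPc]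
        exact ⟨hP.trans inter_subset_right, by omega⟩
      refine (card_le_card hsub).trans (card_image_le.trans ?_)
      rw [card_product, card_powerset, card_powersetCard, card_univ, Fintype.card_fin]
      exact Nat.mul_le_mul_right _ (Nat.pow_le_pow_right (by norm_num) hV)
  -- some fibre is big
  have hfib : ∃ W ∈ powersetCard (r - k) (univ : Finset (Fin n)), (2 * k - 1).choose k ≤
      ((H.filter (fun E => (E ∩ V).card = k)).filter (fun E => E \ V = W)).card := by
    by_contra hcon
    push Not at hcon
    have hle := card_le_mul_card_image_of_maps_to (s := H.filter (fun E => (E ∩ V).card = k))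
      (t := powersetCard (r - k) (univ : Finset (Fin n))) (f := fun E => E \ V) (by
        intro E hE
        rw [mem_filter] at hE
        rw [mem_powersetCard_univ]
        have := card_inter_add_card_sdiff E V
        rw [hr E hE.1] at this
        omega) ((2 * k - 1).choose k - 1) (fun W hW => by have := hcon W hW; omega)
    rw [card_powersetCard, card_univ, Fintype.card_fin] at hle
    have := card_filter_add_card_filter_not (s := H) (fun E => (E ∩ V).card = k)
    omega
  obtain ⟨W, hW, hWc⟩ := hfib
  rw [mem_powersetCard_univ] at hW
  obtain ⟨F, hFdef⟩ : ∃ F, F = ((H.filter (fun E => (E ∩ V).card = k)).filter (fun E => E \ V = W)).image (fun E => E ∩ V) := ⟨_, rfl⟩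
  have hFm : ∀ A, A ∈ F ↔ ∃ E ∈ H, (E ∩ V).card = k ∧ E \ V = W ∧ E ∩ V = A := by
    intro A
    rw [hFdef]
    simp only [mem_image, mem_filter, and_assoc]
  have hFc : (2 * k - 1).choose k ≤ F.card := by
    rw [hFdef, card_image_of_injOn]
    · exact hWc
    · intro E hE E' hE' h
      simp only [coe_filter, mem_filter, Set.mem_ofPred_eq] at hE hE'
      simp only at h
      rw [← sdiff_union_inter E V, ← sdiff_union_inter E' V, h, hE.2, hE'.2]
  have hFr : ∀ A ∈ F, A.card = k := by
    intro A hA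
    obtain ⟨E, _, h, _, rfl⟩ := (hFm A).1 hA
    exact h
  have hFt : ∀ A ∈ F, ∀ E ∈ H, (E ∩ A).Nonempty := by
    intro A hA
    obtain ⟨E, hE, _, _, rfl⟩ := (hFm A).1 hA
    exact hVE E hE
  have hFi : ∀ a ∈ F, ∀ b ∈ F, (a ∩ b).Nonempty := by
    intro a ha b hb
    obtain ⟨E, hE, _, _, rfl⟩ := (hFm a).1 ha
    obtain ⟨E', hE', _, _, rfl⟩ := (hFm b).1 hb
    apply (hVE E hE E' hE').mono
    intro x
    simp only [mem_inter]; tauto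
  have hFd : ∀ A ∈ F, ∀ x ∈ A, k ≤ (F.filter fun h => A.erase x ⊆ h).card := by
    intro A hA x hx
    obtain ⟨E, hE, h1, h2, rfl⟩ := (hFm A).1 hA
    rw [mem_inter] at hx
    refine (hd E hE x hx.1).trans ?_
    have hWE : ∀ E' ∈ H.filter (fun h => E.erase x ⊆ h), (E' ∩ V).card = k ∧ E' \ V = W := by
      intro E' hE'
      rw [mem_filter] at hE'
      have hWs : W ⊆ E' \ V := by
        rw [← h2]
        intro y hy
        rw [mem_sdiff] at hy ⊢
        exact ⟨hE'.2 (mem_erase.2 ⟨fun h => hy.2 (h ▸ hx.2), hy.1⟩), hy.2⟩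
      have g1 := card_inter_add_card_sdiff E' V
      rw [hr E' hE'.1] at g1
      have g2 := hVk E' hE'.1
      have g3 := card_le_card hWs
      refine ⟨by omega, (eq_of_subset_of_card_le hWs (by omega)).symm⟩
    apply card_le_card_of_injOn (fun E' => E' ∩ V)
    · intro E' hE'
      obtain ⟨g1, g2⟩ := hWE E' hE'
      rw [mem_coe, mem_filter] at hE'
      rw [mem_coe, mem_filter]
      refine ⟨(hFm _).2 ⟨E', hE'.1, g1, g2, rfl⟩, ?_⟩
      rw [← erase_inter]
      exact inter_subset_inter_right hE'.2
    · intro E' hE' G hG h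
      simp only at h
      rw [← sdiff_union_inter E' V, ← sdiff_union_inter G V, h, (hWE E' hE').2, (hWE G hG).2]
  have hpart : ∀ A : Finset (Fin n), ∃ S : Finset (Fin n), A ∈ F →
      (S.card + 1 = k ∧ Disjoint A S ∧ ∀ B ∈ F, B ≠ A → ¬ Disjoint B S) := by
    intro A
    by_cases hA : A ∈ F
    · obtain ⟨S, hS⟩ := aux_partner k F hFr hFi hFd A hA
      exact ⟨S, fun _ => hS⟩
    · exact ⟨∅, fun h => absurd h hA⟩
  choose S hS using hpart
  obtain ⟨X, hX, hXF⟩ := aux_bollobas k hk F S hFr (fun A hA => (hS A hA).1)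
    (fun A hA => (hS A hA).2.1) (fun A hA => (hS A hA).2.2) hFc
  refine ⟨X, hX, fun E hE => ?_⟩
  by_contra hlt
  have g1 := card_inter_add_card_sdiff X E
  rw [inter_comm] at g1
  obtain ⟨C, hC, hCc⟩ := exists_subset_card_eq (show k ≤ (X \ E).card by omega)
  obtain ⟨z, hz⟩ := hFt C (hXF C (hC.trans sdiff_subset) hCc) E hE
  rw [mem_inter] at hz
  exact (mem_sdiff.1 (hC hz.2)).2 hz.1


end AuxPart

/-- For fixed r ≥ k ≥ 1 and n sufficiently large, every intersecting r-uniform n-vertex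
hypergraph with minimum positive co-degree at least k has at most
∑_{i=k}^{min(r,2k-1)} C(2k-1,i)·C(n-2k+1, r-i) hyperedges, with equality iff it is a
k-kernel system. -/
theorem stmt_12 (r k : ℕ) (hk : 1 ≤ k) (hkr : k ≤ r) :
    ∃ n₀ : ℕ, ∀ n, n₀ ≤ n → ∀ H : Finset (Finset (Fin n)),
      (∀ h ∈ H, h.card = r) →
      (∀ a ∈ H, ∀ b ∈ H, (a ∩ b).Nonempty) →
      (∀ S : Finset (Fin n), S.card = r - 1 → (∃ h ∈ H, S ⊆ h) →
        k ≤ (H.filter fun h => S ⊆ h).card) →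
      (H.card ≤ ∑ i ∈ Finset.Icc k (min r (2 * k - 1)),
          (2 * k - 1).choose i * (n - (2 * k - 1)).choose (r - i)) ∧
      (H.card = ∑ i ∈ Finset.Icc k (min r (2 * k - 1)),
          (2 * k - 1).choose i * (n - (2 * k - 1)).choose (r - i) ↔
        ∃ X : Finset (Fin n), X.card = 2 * k - 1 ∧
          H = (Finset.univ.powersetCard r).filter
            (fun E : Finset (Fin n) => k ≤ (E ∩ X).card)) := by 
  obtain ⟨n₀, hn₀⟩ := aux_main r k hk hkr
  refine ⟨n₀, fun n hn H hr hi hd => ?_⟩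
  have hterm : (2 * k - 1).choose k * (n - (2 * k - 1)).choose (r - k) ≤
      ∑ i ∈ Finset.Icc k (min r (2 * k - 1)),
          (2 * k - 1).choose i * (n - (2 * k - 1)).choose (r - i) :=
    Finset.single_le_sum (f := fun i => (2 * k - 1).choose i * (n - (2 * k - 1)).choose (r - i))
      (fun _ _ => Nat.zero_le _) (Finset.mem_Icc.2 ⟨le_refl _, le_min hkr (by omega)⟩)
  have key : ∑ i ∈ Finset.Icc k (min r (2 * k - 1)),
          (2 * k - 1).choose i * (n - (2 * k - 1)).choose (r - i) ≤ H.card →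
      ∃ X : Finset (Fin n), X.card = 2 * k - 1 ∧
          H ⊆ (Finset.univ.powersetCard r).filter
            (fun E : Finset (Fin n) => k ≤ (E ∩ X).card) := by
    intro h
    obtain ⟨X, hX, hXE⟩ := hn₀ n hn H hr hi hd (hterm.trans h)
    exact ⟨X, hX, fun E hE => Finset.mem_filter.2
      ⟨Finset.mem_powersetCard_univ.2 (hr E hE), hXE E hE⟩⟩
  refine ⟨?_, ?_, ?_⟩
  · by_contra hlt
    obtain ⟨X, hX, hs⟩ := key (by omega)
    have := Finset.card_le_card hs
    rw [aux_count n r k X hX] at this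
    omega
  · intro heq
    obtain ⟨X, hX, hs⟩ := key heq.ge
    exact ⟨X, hX, Finset.eq_of_subset_of_card_le hs (by rw [aux_count n r k X hX, heq])⟩
  · rintro ⟨X, hX, rfl⟩
    exact aux_count n r k X hX
end

section
/- Let A and B be cross-intersecting families on an N-element ground set, where A is a-uniform and B is (a+1)-uniform and intersecting, and N > 2a+1. Then |A| + |B| ≤ C(N, a), with equality if and only if either B is empty and A consists of all a-subsets, or there is a vertex q such that A is the family of all a-sets containing q and B is the family of all (a+1)-sets containing q. -/
open Finset in
/-- Sum over a period is shift-invariant. -/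
lemma k_shift (N : ℕ) (f : ℕ → ℕ) (hf : ∀ k, f (k + N) = f k) (v : ℕ) :
    ∑ i ∈ range N, f (v + i) = ∑ i ∈ range N, f i := by
  induction v with
  | zero => simp
  | succ v ih =>
    rw [← ih]
    have h1 := Finset.sum_range_succ (fun i => f (v + i)) N
    have h2 := Finset.sum_range_succ' (fun i => f (v + i)) N
    have h3 : ∑ i ∈ range N, f (v + 1 + i) = ∑ i ∈ range N, f (v + (i + 1)) :=
      Finset.sum_congr rfl (fun i _ => by congr 1; ring)
    have := hf v
    simp only [Nat.add_zero] at h2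
    omega

structure KData (a m : ℕ) (f g : ℕ → ℕ) : Prop where
  fper : ∀ k, f (k + (2 * a + 2 + m)) = f k
  gper : ∀ k, g (k + (2 * a + 2 + m)) = g k
  f1 : ∀ k, f k ≤ 1
  g1 : ∀ k, g k ≤ 1
  ff : ∀ k k', k + a + 1 ≤ k' → k' + a + 1 ≤ k + (2 * a + 2 + m) → f k + f k' ≤ 1
  fg : ∀ k k', k + a + 1 ≤ k' → k' + a ≤ k + (2 * a + 2 + m) → f k + g k' ≤ 1

lemma KData.shift {a m : ℕ} {f g : ℕ → ℕ} (h : KData a m f g) (v : ℕ) :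
    KData a m (fun i => f (v + i)) (fun i => g (v + i)) where
  fper k := by rw [← add_assoc]; exact h.fper _
  gper k := by rw [← add_assoc]; exact h.gper _
  f1 k := h.f1 _
  g1 k := h.g1 _
  ff k k' h1 h2 := h.ff _ _ (by omega) (by omega)
  fg k k' h1 h2 := h.fg _ _ (by omega) (by omega)

open Finset in
lemma KData.sums {a m : ℕ} {f g : ℕ → ℕ} (h : KData a m f g) (h0 : f 0 = 1) :
    ∑ i ∈ range (2 * a + 2 + m), f i = 1 + ∑ j ∈ range a, (f (1 + j) + f (a + m + 2 + j)) ∧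
    ∑ i ∈ range (2 * a + 2 + m), g i =
      ∑ j ∈ range a, (g (1 + j) + g (a + m + 3 + j)) := by
  constructor
  · rw [show 2 * a + 2 + m = 1 + (a + ((m + 1) + a)) by ring, Finset.sum_range_add,
      Finset.sum_range_add, Finset.sum_range_add, Finset.sum_add_distrib]
    have : ∑ x ∈ range (m + 1), f (1 + (a + x)) = 0 := by
      apply Finset.sum_eq_zero
      intro x hx
      rw [Finset.mem_range] at hx
      have := h.ff 0 (1 + (a + x)) (by omega) (by omega)
      omega
    rw [this]
    have e : ∀ x, 1 + (a + (m + 1 + x)) = a + m + 2 + x := fun x => by ring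
    simp [h0, e]
  · rw [← k_shift _ g h.gper 1]
    rw [show range (2 * a + 2 + m) = range (a + ((m + 2) + a)) by congr 1; ring,
      Finset.sum_range_add, Finset.sum_range_add, Finset.sum_add_distrib]
    have : ∑ x ∈ range (m + 2), g (1 + (a + x)) = 0 := by
      apply Finset.sum_eq_zero
      intro x hx
      rw [Finset.mem_range] at hx
      have := h.fg 0 (1 + (a + x)) (by omega) (by omega)
      omega
    rw [this]
    have e : ∀ x, 1 + (a + (m + 2 + x)) = a + m + 3 + x := fun x => by ring
    simp [e]

lemma KData.pair {a m : ℕ} {f g : ℕ → ℕ} (h : KData a m f g) (j : ℕ) :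
    f (1 + j) + f (a + m + 2 + j) ≤ 1 ∧ f (1 + j) + g (a + m + 3 + j) ≤ 1 ∧
    f (a + m + 2 + j) + g (1 + j) ≤ 1 := by
  refine ⟨h.ff _ _ (by omega) (by omega), h.fg _ _ (by omega) (by omega), ?_⟩
  rw [← h.gper (1 + j)]
  exact h.fg _ _ (by omega) (by omega)

open Finset in
lemma KData.bd0 {a m : ℕ} {f g : ℕ → ℕ} (h : KData a m f g) (h0 : f 0 = 1) :
    ∑ i ∈ range (2 * a + 2 + m), f i ≤ a + 1 ∧
    ∑ i ∈ range (2 * a + 2 + m), f i + ∑ i ∈ range (2 * a + 2 + m), g i ≤ 2 * a + 1 := by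
  obtain ⟨e1, e2⟩ := h.sums h0
  rw [e1, e2]
  constructor
  · have : ∑ j ∈ range a, (f (1 + j) + f (a + m + 2 + j)) ≤ ∑ j ∈ range a, 1 :=
      Finset.sum_le_sum fun j _ => (h.pair j).1
    simp at this
    simp
    omega
  · rw [add_assoc, ← Finset.sum_add_distrib]
    have : ∑ j ∈ range a, (f (1 + j) + f (a + m + 2 + j) + (g (1 + j) + g (a + m + 3 + j)))
        ≤ ∑ j ∈ range a, 2 :=
      Finset.sum_le_sum fun j _ => by
        have := h.pair j
        have := h.g1 (1 + j)
        have := h.g1 (a + m + 3 + j)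
        omega
    simp only [Finset.sum_const, card_range, smul_eq_mul] at this
    omega

open Finset in
lemma KData.bd {a m : ℕ} {f g : ℕ → ℕ} (h : KData a m f g) :
    (a + 1) * ∑ i ∈ range (2 * a + 2 + m), g i + (a + 2 + m) * ∑ i ∈ range (2 * a + 2 + m), f i
      ≤ (a + 1) * (2 * a + 2 + m) := by
  by_cases hz : ∀ k, f k = 0
  · have : ∑ i ∈ range (2 * a + 2 + m), g i ≤ ∑ i ∈ range (2 * a + 2 + m), 1 :=
      Finset.sum_le_sum fun j _ => h.g1 j
    simp only [Finset.sum_const, card_range, smul_eq_mul, mul_one] at this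
    simp only [hz, Finset.sum_const_zero, mul_zero, add_zero]
    gcongr
  · push Not at hz
    obtain ⟨v, hv⟩ := hz
    obtain ⟨b1, b2⟩ := (h.shift v).bd0 (by have := h.f1 v; simp only [add_zero]; omega)
    rw [k_shift _ f h.fper] at b1 b2
    rw [k_shift _ g h.gper] at b2
    nlinarith

open Finset in
lemma KData.tight0 {a m : ℕ} {f g : ℕ → ℕ} (h : KData a m f g) (h0 : f 0 = 1) (h1 : f 1 = 0)
    (ht : (a + 1) * ∑ i ∈ range (2 * a + 2 + m), g i +
      (a + 2 + m) * ∑ i ∈ range (2 * a + 2 + m), f i = (a + 1) * (2 * a + 2 + m)) :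
    ∀ j < a, f (a + m + 2 + j) = 1 ∧ g (a + m + 3 + j) = 1 := by
  obtain ⟨b1, b2⟩ := h.bd0 h0
  obtain ⟨e1, e2⟩ := h.sums h0
  have c1 : ∑ i ∈ range (2 * a + 2 + m), f i = a + 1 := by nlinarith
  have c2 : ∑ i ∈ range (2 * a + 2 + m), g i = a := by
    rw [c1] at ht
    have : (a + 1) * (∑ i ∈ range (2 * a + 2 + m), g i) = (a + 1) * a := by linarith
    exact Nat.eq_of_mul_eq_mul_left (by omega) this
  have d1 : ∀ j ∈ range a, f (1 + j) + f (a + m + 2 + j) = 1 := by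
    apply (Finset.sum_eq_sum_iff_of_le (fun j _ => (h.pair j).1)).1
    simp only [Finset.sum_const, card_range, smul_eq_mul, mul_one]
    omega
  have d2 : ∀ j ∈ range a,
      f (1 + j) + f (a + m + 2 + j) + (g (1 + j) + g (a + m + 3 + j)) = 2 := by
    apply (Finset.sum_eq_sum_iff_of_le (fun j _ => ?_)).1
    · simp only [Finset.sum_const, card_range, smul_eq_mul]
      rw [Finset.sum_add_distrib]
      omega
    · have := h.pair j
      have := h.g1 (1 + j)
      have := h.g1 (a + m + 3 + j)
      omega
  have key : ∀ j < a, f (1 + j) = 0 := by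
    intro j
    induction j with
    | zero => intro _; exact h1
    | succ j ih =>
      intro hj
      have i1 := ih (by omega)
      have i2 := d1 j (by simp; omega)
      have i3 : f (a + m + 2 + j) + g (1 + (j + 1)) ≤ 1 := by
        rw [← h.gper (1 + (j + 1))]
        exact h.fg _ _ (by omega) (by omega)
      have i4 := d2 (j + 1) (by simp; omega)
      have := h.pair (j + 1)
      have := h.f1 (1 + (j + 1))
      omega
  intro j hj
  have := key j hj
  have := d1 j (by simpa using hj)
  have := d2 j (by simpa using hj)
  have := h.pair j
  have := h.g1 (a + m + 3 + j)
  omega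

open Finset in
lemma KData.tight {a m : ℕ} {f g : ℕ → ℕ} (h : KData a m f g) (v : ℕ)
    (h0 : f v = 1) (h1 : f (v + 1) = 0)
    (ht : (a + 1) * ∑ i ∈ range (2 * a + 2 + m), g i +
      (a + 2 + m) * ∑ i ∈ range (2 * a + 2 + m), f i = (a + 1) * (2 * a + 2 + m)) :
    (v ≤ a → f 0 = 1) ∧ (v + 1 ≤ a → g 0 = 1) := by
  have key := (h.shift v).tight0 (by simpa using h0) h1
    (by rw [k_shift _ f h.fper, k_shift _ g h.gper]; exact ht)
  constructor
  · intro hv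
    rcases Nat.eq_zero_or_pos v with rfl | hp
    · exact h0
    · have := (key (a - v) (by omega)).1
      rw [show v + (a + m + 2 + (a - v)) = 0 + (2 * a + 2 + m) by omega, h.fper] at this
      exact this
  · intro hv
    have := (key (a - 1 - v) (by omega)).2
    rw [show v + (a + m + 3 + (a - 1 - v)) = 0 + (2 * a + 2 + m) by omega, h.gper] at this
    exact this

open Finset in
/-- The arc of length `l` from position `k` in the cyclic order `σ`. -/
def karc {N : ℕ} [NeZero N] (σ : Equiv.Perm (Fin N)) (k l : ℕ) : Finset (Fin N) :=
  (range l).image (fun j => σ (Fin.ofNat N (k + j)))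

lemma k_ofNat_inj {N : ℕ} [NeZero N] {x y : ℕ} (hxy : x < y) (hy : y < x + N) :
    Fin.ofNat N x ≠ Fin.ofNat N y := by
  intro h
  have h' : x % N = y % N := by simpa [Fin.ext_iff] using h
  have h2 : N ∣ y - x := (Nat.modEq_iff_dvd' hxy.le).1 h'
  have := Nat.le_of_dvd (by omega) h2
  omega

lemma karc_disj {N : ℕ} [NeZero N] (σ : Equiv.Perm (Fin N)) {k l k' l' : ℕ}
    (h1 : k + l ≤ k') (h2 : k' + l' ≤ k + N) : ¬ (karc σ k l ∩ karc σ k' l').Nonempty := by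
  rintro ⟨x, hx⟩
  simp only [karc, Finset.mem_inter, Finset.mem_image, Finset.mem_range] at hx
  obtain ⟨⟨i, hi, rfl⟩, j, hj, hij⟩ := hx
  have := σ.injective hij
  exact k_ofNat_inj (x := k + i) (y := k' + j) (by omega) (by omega) this.symm

lemma karc_per {N : ℕ} [NeZero N] (σ : Equiv.Perm (Fin N)) (k l : ℕ) :
    karc σ (k + N) l = karc σ k l := by
  unfold karc
  apply Finset.image_congr
  intro j _
  simp only
  congr 1
  ext
  simp only [Fin.val_ofNat]
  rw [show k + N + j = k + j + N by ring, Nat.add_mod_right]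

lemma karc_card {N : ℕ} [NeZero N] (σ : Equiv.Perm (Fin N)) (k l : ℕ) (hl : l ≤ N) :
    (karc σ k l).card = l := by
  unfold karc
  rw [Finset.card_image_of_injOn, Finset.card_range]
  intro i hi j hj hij
  simp at hi hj
  have := σ.injective hij
  rcases lt_trichotomy i j with h | h | h
  · exact absurd this (k_ofNat_inj (by omega) (by omega))
  · exact h
  · exact absurd this.symm (k_ofNat_inj (by omega) (by omega))

lemma karc_succ {N : ℕ} [NeZero N] (σ : Equiv.Perm (Fin N)) (k l : ℕ) :
    karc σ k (l + 1) = insert (σ (Fin.ofNat N (k + l))) (karc σ k l) := by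
  unfold karc
  rw [Finset.range_add_one, Finset.image_insert]

lemma karc_succ' {N : ℕ} [NeZero N] (σ : Equiv.Perm (Fin N)) (k l : ℕ) :
    karc σ k (l + 1) = insert (σ (Fin.ofNat N k)) (karc σ (k + 1) l) := by
  unfold karc
  ext x
  simp only [Finset.mem_image, Finset.mem_range, Finset.mem_insert]
  constructor
  · rintro ⟨j, hj, rfl⟩
    cases j with
    | zero => left; rfl
    | succ j => right; exact ⟨j, by omega, by rw [show k + 1 + j = k + (j + 1) by ring]⟩
  · rintro (rfl | ⟨j, hj, rfl⟩)
    · exact ⟨0, by omega, rfl⟩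
    · exact ⟨j + 1, by omega, by rw [show k + 1 + j = k + (j + 1) by ring]⟩

lemma k_perm_of_list {N : ℕ} [NeZero N] (L : List (Fin N)) (hd : L.Nodup) (hl : L.length = N) :
    ∃ σ : Equiv.Perm (Fin N), ∀ L1 L2 L3 : List (Fin N), L = L1 ++ L2 ++ L3 →
      karc σ L1.length L2.length = L2.toFinset := by
  let φ : Fin N → Fin N := fun i => L[i.val]'(by rw [hl]; exact i.2)
  have hφ : Function.Injective φ := by
    intro i j hij
    ext
    exact (List.Nodup.getElem_inj_iff hd).1 hij
  refine ⟨Equiv.ofBijective φ (Finite.injective_iff_bijective.1 hφ), ?_⟩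
  intro L1 L2 L3 hL
  have hlen : L1.length + L2.length + L3.length = N := by
    have := congrArg List.length hL
    simp only [List.length_append] at this
    omega
  have hval : ∀ j, ∀ hj : j < L2.length, φ (Fin.ofNat N (L1.length + j)) = L2[j] := by
    intro j hj
    have hm : (L1.length + j) % N = L1.length + j := Nat.mod_eq_of_lt (by omega)
    simp only [φ, Fin.val_ofNat, hm, hL]
    rw [List.getElem_append_left (by simp; omega), List.getElem_append_right (by omega)]
    simp
  ext x
  simp only [karc, Finset.mem_image, Finset.mem_range, List.mem_toFinset, Equiv.ofBijective_apply]
  constructor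
  · rintro ⟨j, hj, rfl⟩
    rw [hval j hj]
    exact List.getElem_mem _
  · intro hx
    obtain ⟨j, hj, rfl⟩ := List.getElem_of_mem hx
    exact ⟨j, hj, hval j hj⟩

open Finset in
lemma k_count (N l : ℕ) (hl : l ≤ N) : ∃ c : ℕ, c * N.choose l = N.factorial ∧
    ∀ I s : Finset (Fin N), I.card = l → s.card = l →
      (univ.filter (fun σ : Equiv.Perm (Fin N) => I.image σ = s)).card = c := by
  -- the count is constant in `I` and `s`
  have hex : ∀ I J : Finset (Fin N), I.card = J.card → ∃ τ : Equiv.Perm (Fin N), I.image τ = J := by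
    intro I J h
    obtain ⟨e⟩ : Nonempty ({x // x ∈ I} ≃ {x // x ∈ J}) := by
      rw [← Fintype.card_eq]; simpa using h
    refine ⟨e.extendSubtype, ?_⟩
    apply Finset.eq_of_subset_of_card_le
    · intro x hx
      obtain ⟨y, hy, rfl⟩ := Finset.mem_image.1 hx
      exact e.extendSubtype_mem y hy
    · rw [Finset.card_image_of_injective _ (Equiv.injective _), h]
  have hc : ∀ I s I' s' : Finset (Fin N), I.card = l → s.card = l → I'.card = l → s'.card = l →
      (univ.filter (fun σ : Equiv.Perm (Fin N) => I.image σ = s)).card =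
      (univ.filter (fun σ : Equiv.Perm (Fin N) => I'.image σ = s')).card := by
    intro I s I' s' h1 h2 h3 h4
    obtain ⟨τ, hτ⟩ := hex I' I (by omega)
    obtain ⟨ρ, hρ⟩ := hex s s' (by omega)
    apply Finset.card_equiv ((Equiv.mulLeft ρ).trans (Equiv.mulRight τ))
    intro σ
    have e : I'.image (ρ * σ * τ) = (I.image σ).image ρ := by
      rw [← hτ, Finset.image_image, Finset.image_image]
      rfl
    simp only [Finset.mem_filter, Finset.mem_univ, true_and, Equiv.trans_apply,
      Equiv.coe_mulLeft, Equiv.coe_mulRight]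
    rw [e, ← hρ]
    exact (Finset.image_injective ρ.injective).eq_iff.symm
  obtain ⟨I₀, -, hI₀⟩ := Finset.exists_subset_card_eq (s := (univ : Finset (Fin N))) (n := l)
    (by simpa using hl)
  refine ⟨(univ.filter (fun σ : Equiv.Perm (Fin N) => I₀.image σ = I₀)).card, ?_, ?_⟩
  · have h1 := Finset.card_eq_sum_card_fiberwise (s := (univ : Finset (Equiv.Perm (Fin N))))
      (f := fun σ : Equiv.Perm (Fin N) => I₀.image σ) (t := (univ : Finset (Fin N)).powersetCard l) (by
        intro σ _
        simp [Finset.mem_powersetCard, Finset.card_image_of_injective _ σ.injective, hI₀])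
    rw [Finset.sum_congr rfl (fun s hs => hc I₀ s I₀ I₀ hI₀ (Finset.mem_powersetCard.1 hs).2 hI₀ hI₀)]
      at h1
    simp only [Finset.sum_const, Finset.card_powersetCard, Finset.card_univ, Fintype.card_perm,
      Fintype.card_fin, smul_eq_mul] at h1
    rw [mul_comm]; exact h1.symm
  · intro I s h1 h2
    exact hc _ _ _ _ h1 h2 hI₀ hI₀

open Finset in
lemma k_sum (N l : ℕ) [NeZero N] (hl : l ≤ N) : ∃ c : ℕ, c * N.choose l = N.factorial ∧
    ∀ F : Finset (Finset (Fin N)), (∀ s ∈ F, s.card = l) →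
      ∑ σ : Equiv.Perm (Fin N), ∑ k ∈ range N, (if karc σ k l ∈ F then 1 else 0)
        = N * (F.card * c) := by
  obtain ⟨c, hc, h⟩ := k_count N l hl
  refine ⟨c, hc, fun F hF => ?_⟩
  rw [Finset.sum_comm]
  have : ∀ k ∈ range N, ∑ σ : Equiv.Perm (Fin N), (if karc σ k l ∈ F then 1 else 0)
      = F.card * c := by
    intro k _
    rw [← Finset.card_filter]
    rw [Finset.card_eq_sum_card_fiberwise (f := fun σ => karc σ k l) (t := F) (by
      intro σ hσ; simpa using hσ)]
    rw [Finset.sum_congr rfl (g := fun _ => c), Finset.sum_const, smul_eq_mul]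
    intro s hs
    rw [← h (karc 1 k l) s (karc_card 1 k l hl) (hF s hs)]
    congr 1
    ext σ
    have e : (karc 1 k l).image σ = karc σ k l := by
      unfold karc
      rw [Finset.image_image]
      rfl
    simp only [Finset.mem_filter, Finset.mem_univ, true_and, e]
    constructor
    · exact fun h => h.2
    · exact fun h => ⟨h ▸ hs, h⟩
  rw [Finset.sum_congr rfl this]
  simp

open Finset in
lemma k_star (N a : ℕ) (q : Fin N) :
    ((univ.powersetCard a).filter (fun s => q ∈ s)).card +
    ((univ.powersetCard (a + 1)).filter (fun s => q ∈ s)).card = N.choose a := by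
  have h := Finset.card_filter_add_card_filter_not (s := (univ : Finset (Fin N)).powersetCard a)
    (fun s => q ∈ s)
  rw [Finset.card_powersetCard, Finset.card_univ, Fintype.card_fin] at h
  rw [← h]
  congr 1
  apply Finset.card_nbij' (fun s => s.erase q) (fun s => insert q s)
  · intro s hs
    simp only [coe_filter, mem_powersetCard, Set.mem_ofPred_eq] at hs ⊢
    simp [Finset.card_erase_of_mem hs.2, hs.1.2]
  · intro s hs
    simp only [coe_filter, mem_powersetCard, Set.mem_ofPred_eq] at hs ⊢
    simp [Finset.card_insert_of_notMem hs.2, hs.1.2]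
  · intro s hs
    simp only [coe_filter, mem_powersetCard, Set.mem_ofPred_eq] at hs
    exact Finset.insert_erase hs.2
  · intro s hs
    simp only [coe_filter, mem_powersetCard, Set.mem_ofPred_eq] at hs
    exact Finset.erase_insert hs.2

lemma k_data (a m : ℕ) [NeZero (2 * a + 2 + m)] (A B : Finset (Finset (Fin (2 * a + 2 + m))))
    (hBint : ∀ s ∈ B, ∀ t ∈ B, (s ∩ t).Nonempty)
    (hcross : ∀ s ∈ A, ∀ t ∈ B, (s ∩ t).Nonempty) (σ : Equiv.Perm (Fin (2 * a + 2 + m))) :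
    KData a m (fun k => if karc σ k (a + 1) ∈ B then 1 else 0)
      (fun k => if karc σ k a ∈ A then 1 else 0) where
  fper k := by simp only [karc_per]
  gper k := by simp only [karc_per]
  f1 k := by split_ifs <;> simp
  g1 k := by split_ifs <;> simp
  ff k k' h1 h2 := by
    split_ifs with h3 h4
    · exact absurd (hBint _ h3 _ h4) (karc_disj σ (by omega) (by omega))
    all_goals simp
  fg k k' h1 h2 := by
    split_ifs with h3 h4
    · have := hcross _ h4 _ h3
      rw [Finset.inter_comm] at this
      exact absurd this (karc_disj σ (by omega) (by omega))
    all_goals simp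

open Finset in
/-- An order in which `T` is an initial arc, `C` with `p` is an arc starting at `p`, and `y`
comes right after it. -/
lemma k_order (N a : ℕ) [NeZero N] (C T : Finset (Fin N)) (p y : Fin N) (hp : p ∉ C) (hy : y ∉ C)
    (hpy : p ≠ y) (hC : C.card = a) (hpT : p ∈ T) (hyT : y ∉ T) :
    ∃ σ : Equiv.Perm (Fin N), ∃ v, v + 1 ≤ T.card ∧ karc σ 0 T.card = T ∧
      karc σ v (a + 1) = insert p C ∧ karc σ (v + 1) (a + 1) = insert y C := by
  set l4 := (T \ insert p C).toList with h4
  set l1 := (C ∩ T).toList with h1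
  set l2 := (C \ T).toList with h2
  set l3 := (univ \ (T ∪ insert p (insert y C))).toList with h3
  have hd : (l4 ++ (p :: l1) ++ l2 ++ (y :: l3)).Nodup := by
    simp only [List.nodup_append, List.nodup_cons, h1, h2, h3, h4, Finset.nodup_toList,
      Finset.mem_toList, List.mem_cons, List.mem_append]
    simp only [Finset.mem_inter, Finset.mem_sdiff, Finset.mem_univ, Finset.mem_union,
      Finset.mem_insert]
    grind
  have hfs : (l4 ++ (p :: l1) ++ l2 ++ (y :: l3)).toFinset = univ := by
    ext x
    simp only [List.mem_toFinset, h1, h2, h3, h4,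
      Finset.mem_toList, List.mem_cons, List.mem_append]
    simp only [Finset.mem_inter, Finset.mem_sdiff, Finset.mem_univ, Finset.mem_union,
      Finset.mem_insert]
    grind
  have hl : (l4 ++ (p :: l1) ++ l2 ++ (y :: l3)).length = N := by
    rw [← List.toFinset_card_of_nodup hd, hfs]; simp
  obtain ⟨σ, hσ⟩ := k_perm_of_list _ hd hl
  have hT : (l4 ++ (p :: l1)).toFinset = T := by
    ext x
    simp only [List.mem_toFinset, h1, h4, Finset.mem_toList, List.mem_cons, List.mem_append,
      Finset.mem_inter, Finset.mem_sdiff, Finset.mem_insert]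
    grind
  have hTl : (l4 ++ (p :: l1)).length = T.card := by
    rw [← hT, List.toFinset_card_of_nodup]
    exact hd.sublist (by simp)
  have hCl : l1.length + l2.length = a := by
    simp only [h1, h2, Finset.length_toList]
    rw [Finset.card_inter_add_card_sdiff, hC]
  refine ⟨σ, l4.length, ?_, ?_, ?_, ?_⟩
  · rw [← hTl]; simp
  · have := hσ [] (l4 ++ (p :: l1)) (l2 ++ (y :: l3)) (by simp)
    rw [hTl, hT] at this
    exact this
  · have := hσ l4 ((p :: l1) ++ l2) (y :: l3) (by simp)
    rw [show ((p :: l1) ++ l2).length = a + 1 by simp; omega] at this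
    rw [this]
    ext x
    simp only [List.mem_toFinset, h1, h2, Finset.mem_toList, List.mem_cons, List.mem_append,
      Finset.mem_inter, Finset.mem_sdiff, Finset.mem_insert]
    grind
  · have := hσ (l4 ++ [p]) (l1 ++ l2 ++ [y]) l3 (by simp)
    rw [show (l1 ++ l2 ++ [y]).length = a + 1 by simp; omega,
      show (l4 ++ [p]).length = l4.length + 1 by simp] at this
    rw [this]
    ext x
    simp only [List.mem_toFinset, h1, h2, Finset.mem_toList, List.mem_cons, List.mem_append,
      Finset.mem_inter, Finset.mem_sdiff, Finset.mem_insert]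
    grind

open Finset in
lemma k_avoid (N r : ℕ) (U : Finset (Fin N)) (p : Fin N) (h : U.card + r ≤ N) (hp : p ∈ U) :
    ∃ T : Finset (Fin N), p ∈ T ∧ T.card = r + 1 ∧ ∀ x ∈ T, x ∈ U → x = p := by
  obtain ⟨R, hR, hRc⟩ := Finset.exists_subset_card_eq (s := Uᶜ) (n := r)
    (by rw [Finset.card_compl, Fintype.card_fin]; omega)
  have hd : ∀ x ∈ R, x ∉ U := fun x hx => by simpa using hR hx
  refine ⟨insert p R, by simp, ?_, ?_⟩
  · rw [Finset.card_insert_of_notMem (fun h => hd p h hp), hRc]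
  · intro x hx hU
    rcases Finset.mem_insert.1 hx with h | h
    · exact h
    · exact absurd hU (hd x h)

open Finset in
/-- Uniqueness from tightness on every cyclic order. -/
lemma k_unique (a m : ℕ) [NeZero (2 * a + 2 + m)] (A B : Finset (Finset (Fin (2 * a + 2 + m))))
    (hA : ∀ s ∈ A, s.card = a)
    (hB : ∀ s ∈ B, s.card = a + 1)
    (hBint : ∀ s ∈ B, ∀ t ∈ B, (s ∩ t).Nonempty)
    (hcross : ∀ s ∈ A, ∀ t ∈ B, (s ∩ t).Nonempty)
    (hne : B.Nonempty)
    (ht : ∀ σ : Equiv.Perm (Fin (2 * a + 2 + m)),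
      (a + 1) * ∑ k ∈ range (2 * a + 2 + m), (if karc σ k a ∈ A then 1 else 0) +
      (a + 2 + m) * ∑ k ∈ range (2 * a + 2 + m), (if karc σ k (a + 1) ∈ B then 1 else 0)
        = (a + 1) * (2 * a + 2 + m)) :
    ∃ p, (∀ s ∈ A, p ∈ s) ∧ (∀ s ∈ B, p ∈ s) := by
  -- find an exchange pair
  obtain ⟨C, p, y, hp, hy, hpy, hC, hpB, hyB⟩ : ∃ C : Finset (Fin (2 * a + 2 + m)), ∃ p y,
      p ∉ C ∧ y ∉ C ∧ p ≠ y ∧ C.card = a ∧ insert p C ∈ B ∧ insert y C ∉ B := by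
    obtain ⟨X, hX⟩ := hne
    have hd : (X.toList ++ Xᶜ.toList).Nodup := by
      simp only [List.nodup_append, Finset.nodup_toList, Finset.mem_toList, Finset.mem_compl]
      grind
    obtain ⟨σ, hσ⟩ := k_perm_of_list (X.toList ++ Xᶜ.toList) hd (by
      have := hB X hX
      have h2 := X.card_le_univ
      simp only [Fintype.card_fin] at h2
      simp only [List.length_append, Finset.length_toList, Finset.card_compl, Fintype.card_fin]
      omega)
    have h0 : karc σ 0 (a + 1) ∈ B := by
      have := hσ [] X.toList Xᶜ.toList (by simp)
      rw [Finset.length_toList, hB X hX, Finset.toList_toFinset] at this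
      rw [List.length_nil] at this
      rw [this]; exact hX
    obtain ⟨k, hk, hk'⟩ : ∃ k, karc σ k (a + 1) ∈ B ∧ karc σ (k + 1) (a + 1) ∉ B := by
      by_contra hcon
      push Not at hcon
      have hall : ∀ k, karc σ k (a + 1) ∈ B := fun k => by
        induction k with
        | zero => exact h0
        | succ k ih => exact hcon k ih
      exact karc_disj σ (by omega) (by omega) (hBint _ (hall 0) _ (hall (a + 1)))
    have c1 := hB _ hk
    have c2 : (karc σ (k + 1) (a + 1)).card = a + 1 := karc_card σ _ _ (by omega)
    have c3 : (karc σ (k + 1) a).card = a := karc_card σ _ _ (by omega)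
    rw [karc_succ'] at hk c1
    rw [karc_succ] at hk' c2
    refine ⟨karc σ (k + 1) a, _, _, ?_, ?_, ?_, c3, hk, hk'⟩
    · intro h; rw [Finset.insert_eq_self.2 h] at c1; omega
    · intro h; rw [Finset.insert_eq_self.2 h] at c2; omega
    · intro h; rw [h] at hk; exact hk' hk
  -- all sets with `p`, without `y`
  have fullB : ∀ T : Finset (Fin (2 * a + 2 + m)), T.card = a + 1 → p ∈ T → y ∉ T → T ∈ B := by
    intro T hT hpT hyT
    obtain ⟨σ, v, hv, e1, e2, e3⟩ := k_order _ a C T p y hp hy hpy hC hpT hyT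
    have := ((k_data a m A B hBint hcross σ).tight v (by simp [e2, hpB]) (by simp [e3, hyB])
      (ht σ)).1 (by omega)
    rw [hT] at e1
    simpa [e1] using this
  have fullA : ∀ T : Finset (Fin (2 * a + 2 + m)), T.card = a → p ∈ T → y ∉ T → T ∈ A := by
    intro T hT hpT hyT
    obtain ⟨σ, v, hv, e1, e2, e3⟩ := k_order _ a C T p y hp hy hpy hC hpT hyT
    have := ((k_data a m A B hBint hcross σ).tight v (by simp [e2, hpB]) (by simp [e3, hyB])
      (ht σ)).2 (by omega)
    rw [hT] at e1
    simpa [e1] using this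
  refine ⟨p, ?_, ?_⟩
  · intro W hW
    by_contra hpW
    have hc : (insert p (insert y W)).card ≤ a + 2 := by
      have := Finset.card_insert_le p (insert y W)
      have := Finset.card_insert_le y W
      have := hA W hW
      omega
    obtain ⟨T, h1, h2, h3⟩ := k_avoid _ a (insert p (insert y W)) p (by omega) (by simp)
    have hTB := fullB T h2 h1 (fun h => hpy (h3 y h (by simp)).symm)
    obtain ⟨x, hx⟩ := hcross W hW T hTB
    rw [Finset.mem_inter] at hx
    have := h3 x hx.2 (by simp [hx.1])
    exact hpW (this ▸ hx.1)
  · intro Z hZ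
    by_contra hpZ
    have hZc := hB Z hZ
    by_cases hyZ : y ∈ Z
    · have hc : (insert p Z).card ≤ a + 2 := by
        have := Finset.card_insert_le p Z
        omega
      obtain ⟨T, h1, h2, h3⟩ := k_avoid _ a (insert p Z) p (by omega) (by simp)
      have hTB := fullB T h2 h1 (fun h => hpy (h3 y h (by simp [hyZ])).symm)
      obtain ⟨x, hx⟩ := hBint Z hZ T hTB
      rw [Finset.mem_inter] at hx
      have := h3 x hx.2 (by simp [hx.1])
      exact hpZ (this ▸ hx.1)
    · rcases Nat.eq_zero_or_pos a with ha | ha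
      · have hC0 : C = ∅ := by rw [← Finset.card_eq_zero, hC, ha]
        obtain ⟨x, hx⟩ := hBint Z hZ _ hpB
        rw [hC0] at hx
        simp at hx
        exact hpZ (hx.2 ▸ hx.1)
      · have hc : (insert p (insert y Z)).card ≤ a + 3 := by
          have := Finset.card_insert_le p (insert y Z)
          have := Finset.card_insert_le y Z
          omega
        obtain ⟨T, h1, h2, h3⟩ := k_avoid _ (a - 1) (insert p (insert y Z)) p (by omega) (by simp)
        have hTA := fullA T (by omega) h1 (fun h => hpy (h3 y h (by simp)).symm)
        obtain ⟨x, hx⟩ := hcross T hTA Z hZ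
        rw [Finset.mem_inter] at hx
        have := h3 x hx.1 (by simp [hx.2])
        exact hpZ (this ▸ hx.2)


/-- Frankl: cross-intersecting families A (a-uniform) and B ((a+1)-uniform, intersecting)
on [N] with N > 2a+1 satisfy |A| + |B| ≤ C(N,a), with equality iff B is empty and A is
everything, or both are stars at a common vertex. -/
theorem stmt_13 (N a : ℕ) (hN : 2 * a + 1 < N)
    (A B : Finset (Finset (Fin N)))
    (hA : ∀ s ∈ A, s.card = a)
    (hB : ∀ s ∈ B, s.card = a + 1)
    (hBint : ∀ s ∈ B, ∀ t ∈ B, (s ∩ t).Nonempty)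
    (hcross : ∀ s ∈ A, ∀ t ∈ B, (s ∩ t).Nonempty) :
    A.card + B.card ≤ N.choose a ∧
    (A.card + B.card = N.choose a ↔
      (B = ∅ ∧ A = Finset.univ.powersetCard a) ∨
      (∃ q : Fin N,
        A = (Finset.univ.powersetCard a).filter (fun s => q ∈ s) ∧
        B = (Finset.univ.powersetCard (a + 1)).filter (fun s => q ∈ s))) := by
  obtain ⟨m, rfl⟩ : ∃ m, N = 2 * a + 2 + m := ⟨N - (2 * a + 2), by omega⟩
  haveI : NeZero (2 * a + 2 + m) := ⟨by omega⟩
  obtain ⟨ca, hca, hsA⟩ := k_sum (2 * a + 2 + m) a (by omega)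
  obtain ⟨cb, hcb, hsB⟩ := k_sum (2 * a + 2 + m) (a + 1) (by omega)
  have hsA := hsA A hA
  have hsB := hsB B hB
  have hca0 : 0 < ca := by
    rcases Nat.eq_zero_or_pos ca with h | h
    · rw [h, zero_mul] at hca
      exact absurd hca.symm (Nat.factorial_ne_zero _)
    · exact h
  have hch : (2 * a + 2 + m).choose (a + 1) * (a + 1) = (2 * a + 2 + m).choose a * (a + 2 + m) := by
    have := Nat.choose_succ_right_eq (2 * a + 2 + m) a
    rw [this]; congr 1; omega
  have hrel : (a + 2 + m) * cb = (a + 1) * ca := by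
    have hpos : 0 < (2 * a + 2 + m).choose a * (2 * a + 2 + m).choose (a + 1) :=
      Nat.mul_pos (Nat.choose_pos (by omega)) (Nat.choose_pos (by omega))
    apply Nat.eq_of_mul_eq_mul_right hpos
    calc (a + 2 + m) * cb * ((2 * a + 2 + m).choose a * (2 * a + 2 + m).choose (a + 1))
        = ((2 * a + 2 + m).choose a * (a + 2 + m)) * (cb * (2 * a + 2 + m).choose (a + 1)) := by
          ring
      _ = ((2 * a + 2 + m).choose (a + 1) * (a + 1)) * (ca * (2 * a + 2 + m).choose a) := by
          rw [hcb, ← hca, hch]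
      _ = _ := by ring
  have hle : ∀ σ ∈ (Finset.univ : Finset (Equiv.Perm (Fin (2 * a + 2 + m)))),
      (a + 1) * ∑ k ∈ Finset.range (2 * a + 2 + m), (if karc σ k a ∈ A then 1 else 0) +
      (a + 2 + m) * ∑ k ∈ Finset.range (2 * a + 2 + m), (if karc σ k (a + 1) ∈ B then 1 else 0)
        ≤ (a + 1) * (2 * a + 2 + m) :=
    fun σ _ => (k_data a m A B hBint hcross σ).bd
  have hL : ∑ σ : Equiv.Perm (Fin (2 * a + 2 + m)),
      ((a + 1) * ∑ k ∈ Finset.range (2 * a + 2 + m), (if karc σ k a ∈ A then 1 else 0) +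
      (a + 2 + m) * ∑ k ∈ Finset.range (2 * a + 2 + m), (if karc σ k (a + 1) ∈ B then 1 else 0))
      = ((a + 1) * (2 * a + 2 + m) * ca) * (A.card + B.card) := by
    rw [Finset.sum_add_distrib, ← Finset.mul_sum, ← Finset.mul_sum, hsA, hsB]
    calc _ = (a + 1) * (2 * a + 2 + m) * ca * A.card
          + ((a + 2 + m) * cb) * ((2 * a + 2 + m) * B.card) := by ring
      _ = _ := by rw [hrel]; ring
  have hR : ∑ σ : Equiv.Perm (Fin (2 * a + 2 + m)), (a + 1) * (2 * a + 2 + m)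
      = ((a + 1) * (2 * a + 2 + m) * ca) * (2 * a + 2 + m).choose a := by
    rw [Finset.sum_const, Finset.card_univ, Fintype.card_perm, Fintype.card_fin, ← hca,
      smul_eq_mul]
    ring
  have hK : 0 < (a + 1) * (2 * a + 2 + m) * ca := by positivity
  refine ⟨?_, ?_, ?_⟩
  · have := Finset.sum_le_sum hle
    rw [hL, hR] at this
    exact Nat.le_of_mul_le_mul_left this hK
  · intro heq
    rcases B.eq_empty_or_nonempty with hB0 | hne
    · left
      refine ⟨hB0, ?_⟩
      apply Finset.eq_of_subset_of_card_le
      · intro s hs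
        simp [Finset.mem_powersetCard, hA s hs]
      · rw [Finset.card_powersetCard, Finset.card_univ, Fintype.card_fin, ← heq, hB0]
        simp
    · right
      have ht := (Finset.sum_eq_sum_iff_of_le hle).1 (by rw [hL, hR, heq])
      obtain ⟨p, pA, pB⟩ := k_unique a m A B hA hB hBint hcross hne
        (fun σ => ht σ (Finset.mem_univ _))
      have sA : A ⊆ (Finset.univ.powersetCard a).filter (fun s => p ∈ s) := by
        intro s hs
        simp [Finset.mem_powersetCard, hA s hs, pA s hs]
      have sB : B ⊆ (Finset.univ.powersetCard (a + 1)).filter (fun s => p ∈ s) := by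
        intro s hs
        simp [Finset.mem_powersetCard, hB s hs, pB s hs]
      have hst := k_star (2 * a + 2 + m) a p
      have lA := Finset.card_le_card sA
      have lB := Finset.card_le_card sB
      exact ⟨p, Finset.eq_of_subset_of_card_le sA (by omega),
        Finset.eq_of_subset_of_card_le sB (by omega)⟩
  · rintro (⟨h1, h2⟩ | ⟨q, h1, h2⟩)
    · rw [h1, h2]; simp
    · rw [h1, h2]; exact k_star _ a q
end
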